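/- arXiv:math/0606196 — 8 statements merged into one kernel-verified Lean document; each statement's English description precedes it below -/
import Mathlib

section
/- Let τ be the K-algebra automorphism of P_{n+1} = K[x_1,…,x_{n+1}] (n ≥ 2) with τ(x_1) = x_1 and τ(x_i) = x_i + x_{i−1} for 2 ≤ i ≤ n+1, and set m = ⌊n/2⌋. Then the m+1 elements x_1², p_1, …, p_m form a K-vector-space basis of the space of τ-invariant homogeneous polynomials of degree 2 in P_{n+1}. -/
noncomputable section

variable (K : Type*) [Field K] [CharZero K]

/-- `xv K n k` is the variable `x_k` (1-based indexing) in `K[x_1,…,x_n]`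
(junk value `0` when out of range). -/
def xv (n k : ℕ) : MvPolynomial (Fin n) K :=
  if h : k - 1 < n then MvPolynomial.X ⟨k - 1, h⟩ else 0

/-- The binomial coefficient `C(a,b)` for integers, with the convention that
`C(a,b) = 0` unless `0 ≤ b ≤ a`. -/
def ch (a b : ℤ) : ℤ := if 0 ≤ b ∧ b ≤ a then (a.toNat.choose b.toNat : ℤ) else 0

/-- `λ^k_{i,j} = (−1)^{k−i}(C(k−i, j−k) + C(k−i−1, j−k−1))`. -/
def lam (k i j : ℕ) : ℤ :=
  (-1) ^ (k - i) * (ch ((k : ℤ) - i) ((j : ℤ) - k) + ch ((k : ℤ) - i - 1) ((j : ℤ) - k - 1))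

/-- `μ^k_i = (−1)^{k−1}(C(k, i−k) + C(k−1, i−k−1))`. -/
def mu (k i : ℕ) : ℤ :=
  (-1) ^ (k - 1) * (ch (k : ℤ) ((i : ℤ) - k) + ch ((k : ℤ) - 1) ((i : ℤ) - k - 1))

/-- `α^k_{i,j} = (−1)^{k−i}(2C(k−i−1, j−k−1) + 3C(k−i−1, j−k−2)
  + (k−i−1)(C(k−i, j−k−1) + C(k−i−1, j−k−2)))`. -/
def alph (k i j : ℕ) : ℤ :=
  (-1) ^ (k - i) *
    (2 * ch ((k : ℤ) - i - 1) ((j : ℤ) - k - 1) + 3 * ch ((k : ℤ) - i - 1) ((j : ℤ) - k - 2)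
      + ((k : ℤ) - i - 1) *
        (ch ((k : ℤ) - i) ((j : ℤ) - k - 1) + ch ((k : ℤ) - i - 1) ((j : ℤ) - k - 2)))

/-- `β^k_j = α^k_{1,j−1} + α^k_{1,j} + μ^k_{j−1}`. -/
def bet (k j : ℕ) : ℤ := alph k 1 (j - 1) + alph k 1 j + mu k (j - 1)

/-- `p_k = x_{k+1}² + Σ_{i=1}^{k−1} Σ_{j=k}^{2k−i} λ^k_{i,j} x_{i+1}x_{j+1}
  − x_1·Σ_{i=k}^{2k} μ^k_i x_{i+1}` in `K[x_1,…,x_{n+1}]`. -/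
def p (n k : ℕ) : MvPolynomial (Fin (n + 1)) K :=
  xv K (n + 1) (k + 1) ^ 2
    + ∑ i ∈ Finset.Icc 1 (k - 1), ∑ j ∈ Finset.Icc k (2 * k - i),
        lam k i j • (xv K (n + 1) (i + 1) * xv K (n + 1) (j + 1))
    - xv K (n + 1) 1 * ∑ i ∈ Finset.Icc k (2 * k), mu k i • xv K (n + 1) (i + 1)

/-- `q_1 = x_1³ − x_2³ + 3x_1x_2x_3 + x_1²x_2 − 3x_1²x_4`, and for `k ≥ 2`,
`q_k = −x_2·p_k + x_1 x_{k+1}x_{k+2}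
  + x_1·Σ_{i=1}^{k−1} Σ_{j=k+1}^{2k−i+1} α^k_{i,j} x_{i+1}x_{j+1}
  − x_1²·Σ_{i=k+1}^{2k+1} β^k_i x_{i+1}`. -/
def q (n k : ℕ) : MvPolynomial (Fin (n + 1)) K :=
  if k = 1 then
    xv K (n + 1) 1 ^ 3 - xv K (n + 1) 2 ^ 3
      + 3 * xv K (n + 1) 1 * xv K (n + 1) 2 * xv K (n + 1) 3
      + xv K (n + 1) 1 ^ 2 * xv K (n + 1) 2 - 3 * xv K (n + 1) 1 ^ 2 * xv K (n + 1) 4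
  else
    -(xv K (n + 1) 2) * p K n k + xv K (n + 1) 1 * xv K (n + 1) (k + 1) * xv K (n + 1) (k + 2)
      + xv K (n + 1) 1 *
          ∑ i ∈ Finset.Icc 1 (k - 1), ∑ j ∈ Finset.Icc (k + 1) (2 * k - i + 1),
            alph k i j • (xv K (n + 1) (i + 1) * xv K (n + 1) (j + 1))
      - xv K (n + 1) 1 ^ 2 * ∑ i ∈ Finset.Icc (k + 1) (2 * k + 1), bet k i • xv K (n + 1) (i + 1)

open MvPolynomial Finset

/-- The binomial combination `Σ_t C(s,t) x_{c+t}`. -/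
def binomShift {R : Type*} [CommRing R] (x : ℕ → R) (s c : ℕ) : R :=
  ∑ t ∈ range (s + 1), (s.choose t : R) * x (c + t)

/-- The linear form `Σ_t (C(s+1,t) + C(s,t-1)) x_{c+t}`. -/
def lucasShift {R : Type*} [CommRing R] (x : ℕ → R) (s c : ℕ) : R :=
  binomShift x (s + 1) c + binomShift x s (c + 1)

section Ring

variable {R : Type*} [CommRing R] (x : ℕ → R)

theorem binomShift_succ (s c : ℕ) :
    binomShift x (s + 1) c = binomShift x s c + binomShift x s (c + 1) := by
  have h : ∑ t ∈ range (s + 1), (s.choose (t + 1) : R) * x (c + (t + 1)) + x c =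
      binomShift x s c := by
    rw [binomShift, sum_range_succ' (fun t => (s.choose t : R) * x (c + t)), sum_range_succ]
    simp
  rw [← h, binomShift, sum_range_succ', binomShift]
  simp only [Nat.choose_succ_succ, Nat.cast_add, add_mul, sum_add_distrib, Nat.choose_zero_right,
    Nat.cast_one, one_mul, add_zero, Nat.succ_eq_add_one]
  have h' : ∀ t, c + 1 + t = c + (t + 1) := fun t => by ring
  simp only [h']
  ring

theorem lucasShift_succ (s c : ℕ) :
    lucasShift x (s + 1) c = lucasShift x s c + lucasShift x s (c + 1) := by
  simp only [lucasShift, binomShift_succ x (s + 1), binomShift_succ x s (c + 1)]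
  ring

theorem map_lucasShift {x : ℕ → R} (σ : R →+* R) {s c N : ℕ} (hN : c + s + 1 ≤ N)
    (hσ : ∀ j ≤ N, σ (x (j + 1)) = x (j + 1) + x j) :
    σ (lucasShift x s (c + 1)) = lucasShift x s (c + 1) + lucasShift x s c := by
  have key : ∀ s c, c + s ≤ N →
      σ (binomShift x s (c + 1)) = binomShift x s (c + 1) + binomShift x s c := by
    intro s c h
    simp only [binomShift, map_sum, map_mul, map_natCast, ← sum_add_distrib, ← mul_add]
    refine sum_congr rfl fun t ht => ?_
    rw [show c + 1 + t = c + t + 1 by ring, hσ _ (by simp at ht; omega)]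
  simp only [lucasShift, map_add]
  rw [key _ _ (by omega), key _ _ (by omega)]
  ring

theorem map_alternating_sum {x : ℕ → R} (σ : R →+* R) {k : ℕ}
    (hσ : ∀ j ≤ 2 * k, σ (x (j + 1)) = x (j + 1) + x j) {m : ℕ} (hm : m ≤ k) :
    σ (x (k + 1) ^ 2 + ∑ s ∈ range m, (-1) ^ (s + 1) * (x (k - s) * lucasShift x s (k + 1))) =
      x (k + 1) ^ 2 + ∑ s ∈ range m, (-1) ^ (s + 1) * (x (k - s) * lucasShift x s (k + 1))
        + (-1) ^ m * (x (k - m) * lucasShift x m k) := by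
  induction m with
  | zero =>
    simp [hσ k (by omega), lucasShift, binomShift, sum_range_succ]
    ring
  | succ m ih =>
    obtain ⟨d, rfl⟩ : ∃ d, k = m + 1 + d := Nat.exists_eq_add_of_le hm
    have ih := ih (by omega)
    rw [sum_range_succ, ← add_assoc, map_add, ih, map_mul, map_mul,
      map_lucasShift σ (N := 2 * (m + 1 + d)) (by omega) hσ, lucasShift_succ,
      show m + 1 + d - m = d + 1 by omega, show m + 1 + d - (m + 1) = d by omega,
      hσ d (by omega)]
    simp
    ring

end Ring

theorem ch_natCast (a b : ℕ) : ch a b = a.choose b := by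
  unfold ch
  split_ifs with h
  · simp
  · rw [Nat.choose_eq_zero_of_lt (by omega)]; simp

theorem mu_eq_neg_lam {k : ℕ} (hk : 1 ≤ k) (i : ℕ) : mu k i = -lam k 0 i := by
  obtain ⟨k, rfl⟩ := Nat.exists_eq_add_of_le' hk
  simp [mu, lam, pow_succ]

theorem sum_lam_smul {R : Type*} [CommRing R] (x : ℕ → R) {k s : ℕ} (hs : s < k) :
    ∑ j ∈ Icc k (2 * k - (k - 1 - s)), lam k (k - 1 - s) j • (x (k - 1 - s + 1) * x (j + 1)) =
      (-1) ^ (s + 1) * (x (k - s) * lucasShift x s (k + 1)) := by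
  obtain ⟨d, rfl⟩ : ∃ d, k = s + 1 + d := Nat.exists_eq_add_of_le hs
  have h1 : s + 1 + d - 1 - s = d := by omega
  have h2 : s + 1 + d - s = d + 1 := by omega
  have h3 : Icc (s + 1 + d) (2 * (s + 1 + d) - d) =
      Ico (s + 1 + d) (s + 1 + d + (s + 2)) := by ext; simp; omega
  rw [h1, h2, h3, sum_Ico_eq_sum_range, Nat.add_sub_cancel_left]
  have h4 : ∀ t : ℕ, lam (s + 1 + d) d (s + 1 + d + t) =
      (-1) ^ (s + 1) * (((s + 1).choose t : ℤ) + ch s ((t : ℤ) - 1)) := by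
    intro t
    rw [lam, ← ch_natCast, Nat.add_sub_cancel]
    congr 3 <;> push_cast <;> ring
  have h5 : ch s ((0 : ℕ) - 1 : ℤ) = 0 := by simp [ch]
  have h6 : ∀ t : ℕ, ch s (((t + 1 : ℕ) : ℤ) - 1) = s.choose t := by
    intro t
    rw [← ch_natCast]; congr 1; push_cast; ring
  simp only [h4, zsmul_eq_mul]
  push_cast
  simp only [mul_add, add_mul, sum_add_distrib, lucasShift, binomShift, mul_sum]
  congr 1
  · refine sum_congr rfl fun t _ => ?_
    rw [show s + 1 + d + t + 1 = s + 1 + d + 1 + t by ring]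
    ring
  · rw [sum_range_succ']
    simp only [h5, h6]
    simp only [Int.cast_zero, mul_zero, zero_mul, add_zero, Int.cast_natCast]
    refine sum_congr rfl fun t _ => ?_
    rw [show s + 1 + d + (t + 1) + 1 = s + 1 + d + 1 + 1 + t by ring]
    ring

section Poly

variable {K : Type*} [Field K]

/-- The variable `x_k`, with the convention `x_0 = 0`. -/
def xv₀ (K : Type*) [Field K] (N k : ℕ) : MvPolynomial (Fin N) K :=
  if k = 0 then 0 else xv K N k

theorem xv₀_succ (N k : ℕ) : xv₀ K N (k + 1) = xv K N (k + 1) := by simp [xv₀]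

theorem xv_succ {N k : ℕ} (h : k < N) : xv K N (k + 1) = X ⟨k, h⟩ := by simp [xv, h]

theorem p_eq_alternating_sum (n : ℕ) {k : ℕ} (hk : 1 ≤ k) :
    p K n k = xv₀ K (n + 1) (k + 1) ^ 2 + ∑ s ∈ range k,
      (-1) ^ (s + 1) * (xv₀ K (n + 1) (k - s) * lucasShift (xv₀ K (n + 1)) s (k + 1)) := by
  have h1 := sum_range_reflect (fun i => ∑ j ∈ Icc k (2 * k - i),
    lam k i j • (xv₀ K (n + 1) (i + 1) * xv₀ K (n + 1) (j + 1))) k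
  rw [← sum_congr rfl fun s hs => sum_lam_smul (xv₀ K (n + 1)) (mem_range.1 hs), h1]
  obtain ⟨k, rfl⟩ := Nat.exists_eq_add_of_le' hk
  rw [sum_range_succ', p]
  have h2 : Icc 1 (k + 1 - 1) = Ico 1 (k + 1) := rfl
  rw [h2, sum_Ico_eq_sum_range]
  simp only [xv₀_succ, mu_eq_neg_lam hk, Nat.add_sub_cancel, mul_sum, Nat.sub_zero, zero_add,
    neg_smul, mul_neg, sum_neg_distrib, sub_neg_eq_add, mul_smul_comm, add_comm 1]
  rw [add_assoc]

theorem map_p {n k : ℕ} (hk : 1 ≤ k) (hkn : 2 * k ≤ n)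
    (σ : MvPolynomial (Fin (n + 1)) K →ₐ[K] MvPolynomial (Fin (n + 1)) K)
    (hσ : ∀ j ≤ n, σ (xv₀ K (n + 1) (j + 1)) = xv₀ K (n + 1) (j + 1) + xv₀ K (n + 1) j) :
    σ (p K n k) = p K n k := by
  rw [p_eq_alternating_sum n hk]
  refine (map_alternating_sum (x := xv₀ K (n + 1)) σ.toRingHom
    (fun j hj => hσ j (hj.trans hkn)) le_rfl).trans ?_
  simp [xv₀]

theorem isHomogeneous_xv (N k : ℕ) : (xv K N k).IsHomogeneous 1 := by
  unfold xv
  split_ifs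
  · exact isHomogeneous_X _ _
  · exact isHomogeneous_zero _ _ _

theorem isHomogeneous_p (n k : ℕ) : (p K n k).IsHomogeneous 2 := by
  have h : ∀ i j, (xv K (n + 1) i * xv K (n + 1) j).IsHomogeneous 2 := fun i j =>
    (isHomogeneous_xv _ i).mul (isHomogeneous_xv _ j)
  simp only [← mem_homogeneousSubmodule] at h ⊢
  simp only [p, pow_two, mul_sum, mul_smul_comm]
  exact sub_mem (add_mem (h _ _) (sum_mem fun i _ => sum_mem fun j _ => zsmul_mem (h _ _) _))
    (sum_mem fun i _ => zsmul_mem (h _ _) _)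

theorem eval_single_xv {N k : ℕ} (hk : k < N) (l : Fin N) :
    eval (Pi.single l 1) (xv K N (k + 1)) = if k = l then 1 else 0 := by
  rw [xv_succ hk, eval_X, Pi.single_apply]
  simp [Fin.ext_iff]

theorem eval_single_xv_mul_xv {N i j : ℕ} (hij : i < j) (l : Fin N) :
    eval (Pi.single l (1 : K)) (xv K N (i + 1)) * eval (Pi.single l 1) (xv K N (j + 1)) = 0 := by
  by_cases hj : j < N
  · rw [eval_single_xv hj, eval_single_xv (hij.trans hj)]
    split_ifs <;> first | omega | simp
  · simp [xv, hj]

theorem eval_single_p {n k : ℕ} (hk : 1 ≤ k) (hkn : k ≤ n) (l : Fin (n + 1)) :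
    eval (Pi.single l 1) (p K n k) = if k = l then 1 else 0 := by
  simp only [p, map_sub, map_add, map_pow, map_sum, map_zsmul, map_mul, mul_sum, mul_smul_comm]
  rw [sum_eq_zero (s := Icc 1 (k - 1)), sum_eq_zero (s := Icc k (2 * k)),
    eval_single_xv (by omega)]
  · simp
  · intro i hi
    rw [mem_Icc] at hi
    rw [eval_single_xv_mul_xv (i := 0) (by omega), smul_zero]
  · intro i hi
    refine sum_eq_zero fun j hj => ?_
    rw [mem_Icc] at hi hj
    rw [eval_single_xv_mul_xv (by omega), smul_zero]

theorem eval_single_of_isHomogeneous {N d : ℕ} {f : MvPolynomial (Fin N) K}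
    (hf : f.IsHomogeneous d) (l : Fin N) :
    eval (Pi.single l 1) f = coeff (Finsupp.single l d) f := by
  rw [eval_eq', sum_eq_single (Finsupp.single l d)]
  · rw [prod_eq_one, mul_one]
    intro i _
    by_cases h : i = l
    · simp [h]
    · simp [Ne.symm h]
  · intro m hm hne
    have hdeg : m.degree = d := by
      by_contra h
      exact mem_support_iff.1 hm (hf.coeff_eq_zero h)
    obtain ⟨i, hil, hi⟩ : ∃ i, i ≠ l ∧ m i ≠ 0 := by
      by_contra! h
      have hm' : m = Finsupp.single l (m l) := by
        ext i
        by_cases hi : i = l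
        · simp [hi]
        · simp [h i hi, Ne.symm hi]
      apply hne
      rw [hm', Finsupp.degree_single] at hdeg
      rw [hm', hdeg]
    rw [prod_eq_zero (mem_univ i), mul_zero]
    simp [hil, hi]
  · intro h
    simp [notMem_support_iff.1 h]

/-- The partial derivative with respect to the `i`-th variable, zero when out of range. -/
def pderivNat (K : Type*) [Field K] (N i : ℕ) :
    Derivation K (MvPolynomial (Fin N) K) (MvPolynomial (Fin N) K) :=
  if h : i < N then pderiv ⟨i, h⟩ else 0

theorem pderivNat_xv₀ {N : ℕ} (i j : ℕ) (hj : j ≤ N) :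
    pderivNat K N i (xv₀ K N j) = if j = i + 1 then 1 else 0 := by
  rcases j with _ | j
  · simp [xv₀]
  · rw [xv₀_succ, xv_succ hj, pderivNat]
    split_ifs with h1 h2 h2
    · simp [Nat.succ_injective h2]
    · rw [pderiv_X_of_ne]
      simp [Fin.ext_iff]; omega
    · omega
    · simp

theorem pderivNat_map {N : ℕ} (σ : MvPolynomial (Fin N) K →ₐ[K] MvPolynomial (Fin N) K)
    (hσ : ∀ j < N, σ (xv₀ K N (j + 1)) = xv₀ K N (j + 1) + xv₀ K N j) (i : ℕ)
    (f : MvPolynomial (Fin N) K) :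
    pderivNat K N i (σ f) = σ (pderivNat K N i f + pderivNat K N (i + 1) f) := by
  induction f using MvPolynomial.induction_on with
  | C a => simp [← algebraMap_eq]
  | add f g hf hg => simp only [map_add, hf, hg]; ring
  | mul_X f j hf =>
    have hX : X j = xv₀ K N (j + 1) := by rw [xv₀_succ, xv_succ j.2]
    have hj := j.2
    simp only [map_add] at hf
    rw [hX, map_mul]
    simp only [Derivation.leibniz, map_add, map_mul, smul_eq_mul, hf, hσ j hj,
      pderivNat_xv₀ (N := N) i (j + 1) hj, pderivNat_xv₀ (N := N) (i + 1) (j + 1) hj,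
      pderivNat_xv₀ (N := N) i j hj.le, apply_ite σ, map_one, map_zero, add_left_inj]
    ring

/-- The constant term of the second partial derivative `∂_i ∂_j f`. -/
def hessianZero {N : ℕ} (f : MvPolynomial (Fin N) K) (i j : ℕ) : K :=
  constantCoeff (pderivNat K N i (pderivNat K N j f))

theorem hessianZero_comm {N : ℕ} (f : MvPolynomial (Fin N) K) (i j : ℕ) :
    hessianZero f i j = hessianZero f j i := by
  unfold hessianZero pderivNat
  split_ifs with hi hj
  · simp only [constantCoeff_eq, coeff_pderiv, zero_add, Finsupp.coe_zero, Pi.zero_apply,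
      Finsupp.single_apply, add_comm (Finsupp.single (⟨i, hi⟩ : Fin N) 1), eq_comm (a := i),
      Fin.mk.injEq]
  all_goals simp

theorem hessianZero_of_le {N : ℕ} (f : MvPolynomial (Fin N) K) {i : ℕ} (j : ℕ) (hi : N ≤ i) :
    hessianZero f i j = 0 := by
  simp [hessianZero, pderivNat, not_lt.2 hi]

theorem hessianZero_self {N : ℕ} (f : MvPolynomial (Fin N) K) (l : Fin N) :
    hessianZero f l l = 2 * coeff (Finsupp.single l 2) f := by
  simp only [hessianZero, pderivNat, l.2, dite_true, constantCoeff_eq, coeff_pderiv,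
    ← Finsupp.single_add, zero_add]
  simp
  ring

theorem constantCoeff_map {N : ℕ} (σ : MvPolynomial (Fin N) K →ₐ[K] MvPolynomial (Fin N) K)
    (hσ : ∀ j < N, σ (xv₀ K N (j + 1)) = xv₀ K N (j + 1) + xv₀ K N j)
    (f : MvPolynomial (Fin N) K) : constantCoeff (σ f) = constantCoeff f := by
  have h0 : ∀ j, constantCoeff (xv₀ K N j) = 0 := by
    intro j
    unfold xv₀ xv
    split_ifs <;> simp
  induction f using MvPolynomial.induction_on with
  | C a => simp [← algebraMap_eq]
  | add f g hf hg => simp only [map_add, hf, hg]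
  | mul_X f j hf =>
    have hX : X j = xv₀ K N (j + 1) := by rw [xv₀_succ, xv_succ j.2]
    rw [hX, map_mul, hσ j j.2]
    simp [h0]

theorem hessianZero_of_map_eq {N : ℕ} (σ : MvPolynomial (Fin N) K →ₐ[K] MvPolynomial (Fin N) K)
    (hσ : ∀ j < N, σ (xv₀ K N (j + 1)) = xv₀ K N (j + 1) + xv₀ K N j)
    {f : MvPolynomial (Fin N) K} (hf : σ f = f) (i j : ℕ) :
    hessianZero f (i + 1) j + hessianZero f i (j + 1) + hessianZero f (i + 1) (j + 1) = 0 := by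
  have h : hessianZero f i j = constantCoeff (pderivNat K N i (pderivNat K N j (σ f))) := by
    rw [hf, hessianZero]
  rw [pderivNat_map σ hσ, pderivNat_map σ hσ, constantCoeff_map σ hσ] at h
  simp only [map_add] at h
  simp only [hessianZero] at h ⊢
  linear_combination -h

theorem eq_zero_of_hessianZero_eq_zero [CharZero K] {N : ℕ} {f : MvPolynomial (Fin N) K}
    (hf : f.IsHomogeneous 2) (h : ∀ i j, hessianZero f i j = 0) : f = 0 := by
  ext m
  rw [coeff_zero]
  by_contra hm
  have hdeg : m.degree = 2 := by
    by_contra h'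
    exact hm (hf.coeff_eq_zero h')
  obtain ⟨i, j, rfl⟩ : ∃ i j, m = 0 + Finsupp.single i 1 + Finsupp.single j 1 := by
    have hne : ∀ m : Fin N →₀ ℕ, m.degree ≠ 0 → ∃ i m', m = m' + Finsupp.single i 1 := by
      intro m hm
      obtain ⟨i, hi⟩ : ∃ i, m i ≠ 0 := by
        by_contra! h'
        exact hm (by simp [show m = 0 from Finsupp.ext h'])
      refine ⟨i, m - Finsupp.single i 1, (tsub_add_cancel_of_le ?_).symm⟩
      simpa using Nat.one_le_iff_ne_zero.2 hi
    obtain ⟨j, m', rfl⟩ := hne m (by omega)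
    rw [map_add, Finsupp.degree_single] at hdeg
    obtain ⟨i, m'', rfl⟩ := hne m' (by omega)
    rw [map_add, Finsupp.degree_single] at hdeg
    refine ⟨i, j, ?_⟩
    rw [(Finsupp.degree_eq_zero_iff m'').1 (by omega)]
  have hij := h i j
  simp only [hessianZero, pderivNat, i.2, j.2, dite_true, constantCoeff_eq, coeff_pderiv] at hij
  exact hm ((mul_eq_zero.1 ((mul_eq_zero.1 hij).resolve_right
    (Nat.cast_add_one_ne_zero _))).resolve_right (Nat.cast_add_one_ne_zero _))

end Poly

theorem eq_zero_of_antidiagonal_recurrence {K : Type*} [Field K] [CharZero K] {b : ℕ → ℕ → K}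
    {n : ℕ} (hsymm : ∀ i j, b i j = b j i) (hfin : ∀ i j, n < i → b i j = 0)
    (hrec : ∀ i j, b (i + 1) j + b i (j + 1) + b (i + 1) (j + 1) = 0)
    (hdiag : ∀ k ≤ n / 2, b k k = 0) (i j : ℕ) : b i j = 0 := by
  suffices H : ∀ e i j, 2 * n + 1 ≤ i + j + e → b i j = 0 from H (2 * n + 1) i j (by omega)
  intro e
  induction e with
  | zero =>
    intro i j h
    rcases lt_or_ge n i with hi | hi
    · exact hfin i j hi
    · rw [hsymm]; exact hfin j i (by omega)
  | succ e ih =>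
    intro i j h
    have step : ∀ i j, 2 * n + 1 ≤ i + j + 1 + (e + 1) → b (i + 1) j = -b i (j + 1) := by
      intro i j h
      linear_combination hrec i j - ih (i + 1) (j + 1) (by omega)
    have alt : ∀ i j, 2 * n + 1 ≤ i + j + (e + 1) → b i j = (-1) ^ i * b 0 (i + j) := by
      intro i
      induction i with
      | zero => intro j _; simp
      | succ i ihi =>
        intro j h
        rw [step i j (by omega), ihi (j + 1) (by omega), show i + (j + 1) = i + 1 + j by ring]
        ring
    rw [alt i j h]
    suffices b 0 (i + j) = 0 by rw [this, mul_zero]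
    rcases lt_or_ge n (i + j) with hd | hd
    · rw [hsymm]; exact hfin _ _ hd
    rcases Nat.even_or_odd' (i + j) with ⟨c, hc | hc⟩
    · have h1 := alt c c (by omega)
      rw [hdiag c (by omega), ← two_mul, ← hc] at h1
      simpa using h1.symm
    · have h1 := alt (i + j) 0 (by omega)
      rw [add_zero, ← hsymm 0, Odd.neg_one_pow ⟨c, hc⟩] at h1
      have h2 : 2 * b 0 (i + j) = 0 := by linear_combination h1
      simpa using h2

/-- The elements `x_1², p_1, …, p_m` form a `K`-basis of the space of `τ`-invariant
homogeneous polynomials of degree 2 in `K[x_1,…,x_{n+1}]`. -/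
theorem quadratic_invariants_basis_linear_case {K : Type*} [Field K] [CharZero K] {n : ℕ}
    (hn : 2 ≤ n)
    (τ : MvPolynomial (Fin (n + 1)) K ≃ₐ[K] MvPolynomial (Fin (n + 1)) K)
    (hτ1 : τ (xv K (n + 1) 1) = xv K (n + 1) 1)
    (hτ : ∀ k, 2 ≤ k → k ≤ n + 1 → τ (xv K (n + 1) k) = xv K (n + 1) k + xv K (n + 1) (k - 1)) :
    LinearIndependent K
        (fun k : Fin (n / 2 + 1) =>
          if (k : ℕ) = 0 then xv K (n + 1) 1 ^ 2 else p K n (k : ℕ))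
    ∧ (Submodule.span K
          (Set.range fun k : Fin (n / 2 + 1) =>
            if (k : ℕ) = 0 then xv K (n + 1) 1 ^ 2 else p K n (k : ℕ)) :
          Set (MvPolynomial (Fin (n + 1)) K))
        = {pp : MvPolynomial (Fin (n + 1)) K | τ pp = pp ∧ pp.IsHomogeneous 2} := by
  set v : Fin (n / 2 + 1) → MvPolynomial (Fin (n + 1)) K :=
    fun k => if (k : ℕ) = 0 then xv K (n + 1) 1 ^ 2 else p K n (k : ℕ) with hv
  have hσ : ∀ j < n + 1, (τ : MvPolynomial (Fin (n + 1)) K →ₐ[K] MvPolynomial (Fin (n + 1)) K)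
      (xv₀ K (n + 1) (j + 1)) = xv₀ K (n + 1) (j + 1) + xv₀ K (n + 1) j := by
    intro j hj
    rcases j with _ | j
    · simpa [xv₀] using hτ1
    · simpa [xv₀] using hτ (j + 2) (by omega) (by omega)
  have hinv : ∀ k, τ (v k) = v k := by
    intro k
    have hk' := k.2
    simp only [hv]
    split_ifs with hk
    · rw [map_pow, hτ1]
    · exact map_p (n := n) (k := k) (by omega) (by omega) (τ : _ →ₐ[K] _)
        fun j hj => hσ j (by omega)
  have hhom : ∀ k, (v k).IsHomogeneous 2 := by
    intro k
    simp only [hv]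
    split_ifs with hk
    · exact (isHomogeneous_xv _ _).pow 2
    · exact isHomogeneous_p n k
  have heval : ∀ (k : Fin (n / 2 + 1)) (l : Fin (n + 1)),
      eval (Pi.single l 1) (v k) = if (k : ℕ) = l then 1 else 0 := by
    intro k l
    have hk' := k.2
    simp only [hv]
    split_ifs with hk hkl hkl
    · rw [map_pow, eval_single_xv (k := 0) (by omega), if_pos (by omega), one_pow]
    · rw [map_pow, eval_single_xv (k := 0) (by omega), if_neg (by omega), zero_pow two_ne_zero]
    · rw [eval_single_p (by omega) (by omega), if_pos hkl]
    · rw [eval_single_p (by omega) (by omega), if_neg hkl]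
  have hsum : ∀ (c : Fin (n / 2 + 1) → K) (l : Fin (n / 2 + 1)),
      eval (Pi.single (Fin.castLE (by omega) l : Fin (n + 1)) 1) (∑ k, c k • v k) = c l := by
    intro c l
    simp [smul_eval, heval, ← Fin.ext_iff]
  refine ⟨?_, ?_⟩
  · rw [Fintype.linearIndependent_iff]
    intro c hc l
    rw [← hsum c l, hc, map_zero]
  · ext f
    simp only [SetLike.mem_coe, Set.mem_ofPred_eq]
    constructor
    · intro hf
      induction hf using Submodule.span_induction with
      | mem f hf => obtain ⟨k, rfl⟩ := hf; exact ⟨hinv k, hhom k⟩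
      | zero => exact ⟨map_zero _, isHomogeneous_zero _ _ _⟩
      | add f g _ _ hf hg => exact ⟨by rw [map_add, hf.1, hg.1], hf.2.add hg.2⟩
      | smul a f _ hf =>
        exact ⟨by rw [map_smul, hf.1], (homogeneousSubmodule _ K 2).smul_mem a hf.2⟩
    · rintro ⟨hf1, hf2⟩
      set c : Fin (n / 2 + 1) → K := fun l =>
        eval (Pi.single (Fin.castLE (by omega) l : Fin (n + 1)) 1) f with hc
      have hg1 : τ (f - ∑ k, c k • v k) = f - ∑ k, c k • v k := by
        simp only [map_sub, map_sum, map_smul, hf1, hinv]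
      have hg2 : (f - ∑ k, c k • v k).IsHomogeneous 2 :=
        (homogeneousSubmodule _ K 2).sub_mem hf2
          (sum_mem fun k _ => Submodule.smul_mem _ _ (hhom k))
      have hg3 : f - ∑ k, c k • v k = 0 := by
        refine eq_zero_of_hessianZero_eq_zero hg2 fun i j => ?_
        refine eq_zero_of_antidiagonal_recurrence (n := n) (hessianZero_comm _)
          (fun i j hi => hessianZero_of_le _ j hi)
          (hessianZero_of_map_eq (τ : _ →ₐ[K] _) hσ hg1) (fun k hk => ?_) i j
        have := hessianZero_self (f - ∑ k, c k • v k)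
          (Fin.castLE (by omega) (⟨k, by omega⟩ : Fin (n / 2 + 1)) : Fin (n + 1))
        rw [← eval_single_of_isHomogeneous hg2, map_sub, hsum, hc, sub_self, mul_zero] at this
        exact this
      rw [sub_eq_zero.1 hg3]
      exact sum_mem fun k _ => Submodule.smul_mem _ _ (Submodule.subset_span ⟨k, rfl⟩)
end
end

section
/- In the univariate polynomial ring K[x], for every integer i ≥ 1, Σ_{j=1}^{i} (−1)^j φ_{−(i−j)}(x)·φ_{j+1}(x) = −i·φ_{−(i+1)}(x+1). -/
noncomputable section

variable (K : Type*) [Field K] [CharZero K]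

/-- `φ_i(x) = x(x+1)⋯(x+i−1)/i!`, with `φ_0 = 1`. -/
def phiPos (i : ℕ) : Polynomial K :=
  ((i.factorial : K)⁻¹) • ∏ j ∈ Finset.range i, (Polynomial.X + Polynomial.C (j : K))

/-- `φ_{−i}(x) = x(x−1)⋯(x−i+1)/i!`, with `φ_{−0} = 1`. -/
def phiNeg (i : ℕ) : Polynomial K :=
  ((i.factorial : K)⁻¹) • ∏ j ∈ Finset.range i, (Polynomial.X - Polynomial.C (j : K))

open Polynomial in
theorem succ_mul_C_inv_factorial_succ {K : Type*} [Field K] [CharZero K] (i : ℕ) :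
    ((i : K[X]) + 1) * C (((i + 1).factorial : K)⁻¹) = C ((i.factorial : K)⁻¹) := by
  have h₁ : (i : K) + 1 ≠ 0 := Nat.cast_add_one_ne_zero i
  have h₂ : (i.factorial : K) ≠ 0 := Nat.cast_ne_zero.mpr i.factorial_ne_zero
  rw [← map_natCast (C : K →+* K[X]), ← C_1, ← C_add, ← C_mul, Nat.factorial_succ]
  congr 1
  push_cast
  field_simp

open Polynomial in
/-- `(i + 1) φ_{i+1}(x) = (x + i) φ_i(x)`. -/
theorem succ_mul_phiPos_succ {K : Type*} [Field K] [CharZero K] (i : ℕ) :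
    ((i : K[X]) + 1) * phiPos K (i + 1) = (X + (i : K[X])) * phiPos K i := by
  have h := succ_mul_C_inv_factorial_succ (K := K) i
  simp only [phiPos, smul_eq_C_mul, Finset.prod_range_succ, map_natCast]
  linear_combination (∏ j ∈ Finset.range i, (X + (j : K[X]))) * (X + (i : K[X])) * h

open Polynomial in
/-- `(i + 1) φ_{−(i+1)}(x) = (x − i) φ_{−i}(x)`. -/
theorem succ_mul_phiNeg_succ {K : Type*} [Field K] [CharZero K] (i : ℕ) :
    ((i : K[X]) + 1) * phiNeg K (i + 1) = (X - (i : K[X])) * phiNeg K i := by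
  have h := succ_mul_C_inv_factorial_succ (K := K) i
  simp only [phiNeg, smul_eq_C_mul, Finset.prod_range_succ, map_natCast]
  linear_combination (∏ j ∈ Finset.range i, (X - (j : K[X]))) * (X - (i : K[X])) * h

open Polynomial in
/-- `(i + 1) φ_{−(i+1)}(x + 1) = (x + 1) φ_{−i}(x)`. -/
theorem succ_mul_phiNeg_succ_comp {K : Type*} [Field K] [CharZero K] (i : ℕ) :
    ((i : K[X]) + 1) * (phiNeg K (i + 1)).comp (X + 1) = (X + 1) * phiNeg K i := by
  have h := succ_mul_C_inv_factorial_succ (K := K) i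
  have hp : (∏ j ∈ Finset.range (i + 1), (X - (j : K[X]))).comp (X + 1)
      = (∏ j ∈ Finset.range i, (X - (j : K[X]))) * (X + 1) := by
    rw [prod_comp, Finset.prod_range_succ']
    simp
  simp only [phiNeg, smul_eq_C_mul, map_natCast, mul_comp, C_comp, hp]
  linear_combination (∏ j ∈ Finset.range i, (X - (j : K[X]))) * (X + 1) * h

open Polynomial in
/-- Closed form of the partial sums in `eta_identity`, after clearing the factor `x (i + 1)`. -/
theorem X_mul_succ_mul_sum_phiNeg_mul_phiPos {K : Type*} [Field K] [CharZero K] (i m : ℕ)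
    (hm : m ≤ i) :
    X * ((i : K[X]) + 1) *
        ∑ j ∈ Finset.range m, (-1) ^ (j + 1) * (phiNeg K (i - (j + 1)) * phiPos K (j + 2))
      = -(X * (i : K[X]) * (X + 1) * phiNeg K i)
        + (-1) ^ m * ((m : K[X]) + 2) * ((i - m : ℕ) : K[X])
          * (phiNeg K (i - m) * phiPos K (m + 2)) := by
  induction m with
  | zero =>
    have h₀ : phiPos K 0 = 1 := by simp [phiPos]
    have h₁ := succ_mul_phiPos_succ (K := K) 0
    have h₂ := succ_mul_phiPos_succ (K := K) 1
    norm_num [h₀] at h₁ h₂ ⊢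
    rw [h₁] at h₂
    linear_combination (-(i : K[X]) * phiNeg K i) * h₂
  | succ m ih =>
    obtain ⟨k, rfl⟩ := Nat.exists_eq_add_of_le' hm
    have e₁ : k + (m + 1) - m = k + 1 := by omega
    have e₂ : k + (m + 1) - (m + 1) = k := by omega
    have ih := ih (by omega)
    have hp := succ_mul_phiPos_succ (K := K) (m + 2)
    have hn := succ_mul_phiNeg_succ (K := K) k
    rw [Finset.sum_range_succ, mul_add, ih, e₁, e₂, show m + 1 + 2 = m + 2 + 1 by ring]
    push_cast at hp ⊢
    linear_combination
      (-1) ^ m * ((m : K[X]) + 2) * phiPos K (m + 2) * hn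
        + (-1) ^ m * (k : K[X]) * phiNeg K k * hp

/-- For every `i ≥ 1`, `Σ_{j=1}^{i} (−1)^j φ_{−(i−j)}(x)·φ_{j+1}(x) = −i·φ_{−(i+1)}(x+1)`
in `K[x]`. -/
theorem eta_identity {K : Type*} [Field K] [CharZero K] (i : ℕ) (hi : 1 ≤ i) :
    ∑ j ∈ Finset.Icc 1 i, (-1 : Polynomial K) ^ j * (phiNeg K (i - j) * phiPos K (j + 1))
      = -(i : Polynomial K) * (phiNeg K (i + 1)).comp (Polynomial.X + 1) := by
  have hX : (Polynomial.X : Polynomial K) * ((i : Polynomial K) + 1) ≠ 0 :=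
    mul_ne_zero Polynomial.X_ne_zero (Nat.cast_add_one_ne_zero i)
  refine mul_left_cancel₀ hX ?_
  have hsum := X_mul_succ_mul_sum_phiNeg_mul_phiPos (K := K) i i le_rfl
  have hcomp := succ_mul_phiNeg_succ_comp (K := K) i
  rw [← Finset.Ico_add_one_right_eq_Icc, Finset.sum_Ico_eq_sum_range]
  simp only [add_tsub_cancel_right, add_comm 1, add_assoc, one_add_one_eq_two]
  rw [hsum]
  simp only [Nat.sub_self, Nat.cast_zero]
  linear_combination Polynomial.X * (i : Polynomial K) * hcomp
end
end

section
/- Let K be a commutative ring, let a ≤ b be integers, let δ ∈ K, and let λ, μ : ℤ × ℤ → K be functions satisfying λ_{i,j} = δ(λ_{i+1,j−1} + λ_{i+1,j}) + μ_{i,j−1} for all integers i, j with a ≤ i ≤ b−1. Then for every integer c ≥ 0 and all integers i, j with a ≤ i and i + c ≤ b, one has λ_{i,j} = δ^c Σ_{d=0}^{c} C(c,d) λ_{i+c, j−d} + Σ_{c'=0}^{c−1} δ^{c'} Σ_{d'=0}^{c'} C(c',d') μ_{i+c', j−1−d'}. In particular, if μ = 0 then λ_{i,j} = δ^c Σ_{d=0}^{c}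 C(c,d) λ_{i+c, j−d}. -/
/-- Lemma on recursively related coefficient functions:
if `λ_{i,j} = δ(λ_{i+1,j−1} + λ_{i+1,j}) + μ_{i,j−1}` for `a ≤ i ≤ b−1`, then
`λ_{i,j} = δ^c Σ_{d=0}^{c} C(c,d) λ_{i+c,j−d}
  + Σ_{c'=0}^{c−1} δ^{c'} Σ_{d'=0}^{c'} C(c',d') μ_{i+c',j−1−d'}`,
and in particular, when `μ = 0`, `λ_{i,j} = δ^c Σ_{d=0}^{c} C(c,d) λ_{i+c,j−d}`. -/
theorem coefficient_recursion {K : Type*} [CommRing K] (a b : ℤ) (hab : a ≤ b) (δ : K)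
    (lam mu : ℤ → ℤ → K)
    (hrec : ∀ i j : ℤ, a ≤ i → i ≤ b - 1 →
      lam i j = δ * (lam (i + 1) (j - 1) + lam (i + 1) j) + mu i (j - 1)) :
    (∀ (c : ℕ) (i j : ℤ), a ≤ i → i + c ≤ b →
      lam i j = δ ^ c * ∑ d ∈ Finset.range (c + 1), (c.choose d : K) * lam (i + c) (j - d)
        + ∑ c' ∈ Finset.range c, δ ^ c' *
            ∑ d' ∈ Finset.range (c' + 1), (c'.choose d' : K) * mu (i + c') (j - 1 - d'))
    ∧ ((∀ i j : ℤ, mu i j = 0) → ∀ (c : ℕ) (i j : ℤ), a ≤ i → i + c ≤ b →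
      lam i j = δ ^ c * ∑ d ∈ Finset.range (c + 1), (c.choose d : K) * lam (i + c) (j - d)) := by
  have expand : ∀ (c : ℕ) (i j : ℤ), a ≤ i → i + c ≤ b →
      lam i j = δ ^ c * ∑ d ∈ Finset.range (c + 1), (c.choose d : K) * lam (i + c) (j - d)
        + ∑ c' ∈ Finset.range c, δ ^ c' *
            ∑ d' ∈ Finset.range (c' + 1), (c'.choose d' : K) * mu (i + c') (j - 1 - d') := by
    intro c i j hi
    induction c with
    | zero => simp
    | succ c ih =>
      intro hc
      push_cast at hc
      have pascal := Finset.sum_choose_succ_mul (fun d _ => lam (i + (c + 1 : ℕ)) (j - d)) c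
      have step : ∑ d ∈ Finset.range (c + 1), (c.choose d : K) * lam (i + c) (j - d)
          = δ * ∑ d ∈ Finset.range (c + 2),
              ((c + 1).choose d : K) * lam (i + (c + 1 : ℕ)) (j - d)
            + ∑ d ∈ Finset.range (c + 1), (c.choose d : K) * mu (i + c) (j - 1 - d) := by
        rw [pascal, ← Finset.sum_add_distrib, Finset.mul_sum, ← Finset.sum_add_distrib]
        refine Finset.sum_congr rfl fun d _ => ?_
        rw [hrec (i + c) (j - d) (by lia) (by lia)]
        push_cast
        rw [add_assoc i, sub_sub j d 1, sub_sub j 1 d, add_comm (1 : ℤ) d]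
        ring
      rw [ih (by lia), step, Finset.sum_range_succ (fun c' => δ ^ c' *
        ∑ d' ∈ Finset.range (c' + 1), (c'.choose d' : K) * mu (i + c') (j - 1 - d')), pow_succ]
      ring
  refine ⟨expand, fun hmu c i j hi hc => ?_⟩
  simpa [hmu] using expand c i j hi hc
end

section
/- Let K be a commutative ring, let a ≤ b be integers, let δ ∈ K and let γ ∈ K be a unit, and let λ, μ : ℤ × ℤ → K be functions satisfying λ_{i,j} = δ(λ_{i+1,j−1} + λ_{i+1,j}) + μ_{i,j−1} and μ_{i,j} = γ(μ_{i+1,j−1} + μ_{i+1,j}) for all integers i, j with a ≤ i ≤ b−1. Then for every integer c ≥ 0 and all integers i, j with a ≤ i and i + c ≤ b, one has λ_{i,j} = δ^c Σ_{d=0}^{c} C(c,d) λ_{i+c, j−d} + (Σ_{l=0}^{c−1} (δγ^{−1})^l)·μ_{i,j−1}. -/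
/-- If `λ_{i,j} = δ(λ_{i+1,j−1} + λ_{i+1,j}) + μ_{i,j−1}` and
`μ_{i,j} = γ(μ_{i+1,j−1} + μ_{i+1,j})` for `a ≤ i ≤ b−1` with `γ` a unit, then
`λ_{i,j} = δ^c Σ_{d=0}^{c} C(c,d) λ_{i+c,j−d} + (Σ_{l=0}^{c−1} (δγ^{−1})^l)·μ_{i,j−1}`. -/
theorem coefficient_recursion_geometric {K : Type*} [CommRing K] (a b : ℤ) (hab : a ≤ b)
    (δ : K) (γ : Kˣ) (lam mu : ℤ → ℤ → K)
    (hrecl : ∀ i j : ℤ, a ≤ i → i ≤ b - 1 →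
      lam i j = δ * (lam (i + 1) (j - 1) + lam (i + 1) j) + mu i (j - 1))
    (hrecm : ∀ i j : ℤ, a ≤ i → i ≤ b - 1 →
      mu i j = (γ : K) * (mu (i + 1) (j - 1) + mu (i + 1) j)) :
    ∀ (c : ℕ) (i j : ℤ), a ≤ i → i + c ≤ b →
      lam i j = δ ^ c * ∑ d ∈ Finset.range (c + 1), (c.choose d : K) * lam (i + c) (j - d)
        + (∑ l ∈ Finset.range c, (δ * ((γ⁻¹ : Kˣ) : K)) ^ l) * mu i (j - 1) := by
  intro c
  induction c with
  | zero => simp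
  | succ c ih =>
    intro i j hi hc
    push_cast at hc
    have hpascal := Finset.sum_choose_succ_mul (fun d _ ↦ lam (i + 1 + c) (j - d)) c
    have hshift : ∀ d : ℕ, j - 1 - (d : ℤ) = j - ((d + 1 : ℕ) : ℤ) := by
      intro d
      push_cast
      ring
    have hmu : mu (i + 1) (j - 1 - 1) + mu (i + 1) (j - 1)
        = ((γ⁻¹ : Kˣ) : K) * mu i (j - 1) := by
      rw [hrecm i (j - 1) hi (by lia), Units.inv_mul_cancel_left]
    have hindex : i + ((c + 1 : ℕ) : ℤ) = i + 1 + c := by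
      push_cast
      ring
    rw [hrecl i j hi (by lia), ih (i + 1) (j - 1) (by lia) (by lia),
      ih (i + 1) j (by lia) (by lia), hindex, hpascal, geom_sum_succ]
    simp only [hshift]
    linear_combination δ * (∑ l ∈ Finset.range c, (δ * ((γ⁻¹ : Kˣ) : K)) ^ l) * hmu
end

section
/- Let K be a commutative ring, let a ≤ b be integers, let δ ∈ K be a unit, let n ≥ 0, and let λ^0, λ^1, …, λ^n : ℤ × ℤ → K be functions such that for all integers i, j with a ≤ i ≤ b−1: λ^k_{i,j} = δ(λ^k_{i+1,j−1} + λ^k_{i+1,j}) + λ^{k+1}_{i,j−1} for each k = 0, …, n−1, and λ^n_{i,j} = δ(λ^n_{i+1,j−1} + λ^n_{i+1,j}). Then for every integer c ≥ 0 and all integers i, j with a ≤ i and i + c ≤ b, one has λ^0_{i,j} = δ^c Σ_{d=0}^{c} C(c,d) λ^0_{i+c, j−d} + Σ_{k=1}^{n} (−1)^{k−1} C(c,k) λ^k_{i, j−k}. -/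
open Finset in
/-- Pascal's rule for binomial sums of an arbitrary sequence. -/
theorem sum_range_succ_choose_mul {K : Type*} [CommRing K] (u : ℕ → K) (c : ℕ) :
    ∑ k ∈ range (c + 1 + 1), ((c + 1).choose k : K) * u k
      = ∑ k ∈ range (c + 1), (c.choose k : K) * (u k + u (k + 1)) := by
  simpa only [mul_add, sum_add_distrib] using sum_choose_succ_mul (fun k _ => u k) c

open Finset in
/-- For an infinite chain satisfying the recursion, the iterated operator `δ(1 + S)E`, with `S` and
`E` the shifts in the second and first variable, is an alternating binomial sum along the chain. -/
theorem pow_mul_sum_choose_eq_alternating_sum {K : Type*} [CommRing K] (a b : ℤ) (δ : K)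
    (f : ℕ → ℤ → ℤ → K)
    (hf : ∀ (k : ℕ) (i j : ℤ), a ≤ i → i ≤ b - 1 →
      f k i j = δ * (f k (i + 1) (j - 1) + f k (i + 1) j) + f (k + 1) i (j - 1))
    (c : ℕ) (i j : ℤ) (hi : a ≤ i) (hc : i + c ≤ b) :
    δ ^ c * ∑ d ∈ range (c + 1), (c.choose d : K) * f 0 (i + c) (j - d)
      = ∑ k ∈ range (c + 1), (c.choose k : K) * ((-1) ^ k * f k i (j - k)) := by
  induction c generalizing i j with
  | zero => simp
  | succ c ih =>
    push_cast at hc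
    have h₀ := ih (i + 1) j (by lia) (by lia)
    have h₁ := ih (i + 1) (j - 1) (by lia) (by lia)
    have hi' : i + ((c + 1 : ℕ) : ℤ) = i + 1 + c := by push_cast; ring
    rw [sum_range_succ_choose_mul (fun d => f 0 (i + ((c + 1 : ℕ) : ℤ)) (j - d)),
      sum_range_succ_choose_mul (fun k => (-1) ^ k * f k i (j - k)), hi']
    have hj (k : ℕ) : j - ((k + 1 : ℕ) : ℤ) = j - 1 - k := by push_cast; ring
    simp only [hj, mul_add (Nat.cast _ : K), sum_add_distrib (s := range (c + 1))]
    rw [pow_succ', mul_assoc, mul_add (δ ^ c), h₀, h₁, ← sum_add_distrib, ← sum_add_distrib,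
      mul_sum]
    refine sum_congr rfl fun k _ => ?_
    rw [hf k i (j - k) hi (by lia), show j - k - 1 = j - 1 - (k : ℤ) by ring]
    ring


/-- Iterated version: given a chain `λ^0, λ^1, …, λ^n` with
`λ^k_{i,j} = δ(λ^k_{i+1,j−1} + λ^k_{i+1,j}) + λ^{k+1}_{i,j−1}` for `k < n` and
`λ^n_{i,j} = δ(λ^n_{i+1,j−1} + λ^n_{i+1,j})` (for `a ≤ i ≤ b−1`), where `δ` is a unit, one has
`λ^0_{i,j} = δ^c Σ_{d=0}^{c} C(c,d) λ^0_{i+c,j−d} + Σ_{k=1}^{n} (−1)^{k−1} C(c,k) λ^k_{i,j−k}`. -/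
theorem coefficient_recursion_chain {K : Type*} [CommRing K] (a b : ℤ) (hab : a ≤ b)
    (δ : Kˣ) (n : ℕ) (lam : ℕ → ℤ → ℤ → K)
    (hrec : ∀ k : ℕ, k < n → ∀ i j : ℤ, a ≤ i → i ≤ b - 1 →
      lam k i j = (δ : K) * (lam k (i + 1) (j - 1) + lam k (i + 1) j) + lam (k + 1) i (j - 1))
    (hrecn : ∀ i j : ℤ, a ≤ i → i ≤ b - 1 →
      lam n i j = (δ : K) * (lam n (i + 1) (j - 1) + lam n (i + 1) j)) :
    ∀ (c : ℕ) (i j : ℤ), a ≤ i → i + c ≤ b →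
      lam 0 i j
        = (δ : K) ^ c * ∑ d ∈ Finset.range (c + 1), (c.choose d : K) * lam 0 (i + c) (j - d)
          + ∑ k ∈ Finset.Icc 1 n, (-1 : K) ^ (k - 1) * (c.choose k : K) * lam k i (j - k) := by
  intro c i j hi hc
  have key := pow_mul_sum_choose_eq_alternating_sum a b (δ : K)
    (fun k i j => if k ≤ n then lam k i j else 0) (fun k i j hi hb => by
      rcases lt_trichotomy k n with hk | rfl | hk
      · simpa [hk.le, Nat.succ_le_of_lt hk] using hrec k hk i j hi hb
      · simpa using hrecn i j hi hb
      · simp [hk.not_ge, (hk.trans k.lt_succ_self).not_ge]) c i j hi hc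
  simp only [Nat.zero_le, if_true] at key
  have hsum : ∑ k ∈ Finset.range (c + 1),
        (c.choose k : K) * ((-1) ^ k * if k ≤ n then lam k i (j - k) else 0)
      = ∑ k ∈ Finset.range (n + 1), (c.choose k : K) * ((-1) ^ k * lam k i (j - k)) := by
    have hn : Finset.range (n + 1) = {k ∈ Finset.range (max n c + 1) | k ≤ n} := by
      ext k; simp; lia
    rw [hn, Finset.sum_filter]
    refine Finset.sum_subset_zero_on_sdiff (by simp) (fun k hk => ?_) (fun k _ => ?_)
    · have hck : c < k := by simp at hk; lia
      simp [Nat.choose_eq_zero_of_lt hck]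
    · split_ifs <;> simp
  have hIcc : Finset.Icc 1 n = Finset.Ico 1 (n + 1) := by ext k; simp
  rw [key, hsum, hIcc, Finset.sum_Ico_eq_sum_range, Finset.sum_range_succ', add_tsub_cancel_right,
    add_right_comm, ← Finset.sum_add_distrib, Finset.sum_eq_zero fun k _ => ?_]
  · simp
  · rw [add_comm 1 k, add_tsub_cancel_right]
    ring
end

section
/- Let σ be the K-algebra automorphism of Q = K[z_1,…,z_n] (n ≥ 2) with σ(z_1) = z_1 − 1 and σ(z_i) = z_i + z_{i−1} for 2 ≤ i ≤ n. Then every σ-invariant polynomial u ∈ Q^σ satisfies u(z_1, z_2, …, z_n) = u(0, y_2, …, y_n); that is, u is equal to its image under the K-algebra endomorphism of Q sending z_1 ↦ 0 and z_i ↦ y_i for 2 ≤ i ≤ n. -/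
noncomputable section

variable (K : Type*) [Field K] [CharZero K]

/-- `y_{i+1} = Σ_{j=1}^{i} φ_{-(i-j)}(x_1)·x_{j+1} + i·φ_{-(i+1)}(x_1+1)`;
`yv K n i` denotes `y_{i+1}`. -/
def yv (n i : ℕ) : MvPolynomial (Fin n) K :=
  (∑ j ∈ Finset.Icc 1 i, Polynomial.aeval (xv K n 1) (phiNeg K (i - j)) * xv K n (j + 1))
    + (i : MvPolynomial (Fin n) K) * Polynomial.aeval (xv K n 1 + 1) (phiNeg K (i + 1))

open Finset in
theorem phiNeg_succ_aeval {A : Type*} [CommRing A] [Algebra K A] (i : ℕ) (z : A) :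
    ((i : A) + 1) * Polynomial.aeval z (phiNeg K (i + 1)) =
      (z - i) * Polynomial.aeval z (phiNeg K i) := by
  have h : (i : A) + 1 = algebraMap K A (i + 1) := by simp
  have h0 : (i : K) + 1 ≠ 0 := by exact_mod_cast i.succ_ne_zero
  rw [h, ← Algebra.smul_def]
  simp only [phiNeg, map_smul, smul_smul, prod_range_succ, map_mul, map_prod, map_sub,
    Polynomial.aeval_X, map_natCast, Nat.factorial_succ, Nat.cast_mul,
    Nat.cast_succ, mul_inv, mul_inv_cancel_left₀ h0, mul_smul_comm]
  rw [mul_comm]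

open Finset in
theorem phiNeg_succ_aeval_add_one {A : Type*} [CommRing A] [Algebra K A] (i : ℕ) (z : A) :
    ((i : A) + 1) * Polynomial.aeval (z + 1) (phiNeg K (i + 1)) =
      (z + 1) * Polynomial.aeval z (phiNeg K i) := by
  have h : (i : A) + 1 = algebraMap K A (i + 1) := by simp
  have h0 : (i : K) + 1 ≠ 0 := by exact_mod_cast i.succ_ne_zero
  rw [h, ← Algebra.smul_def]
  simp only [phiNeg, map_smul, smul_smul, prod_range_succ', map_mul, map_prod, map_sub,
    Polynomial.aeval_X, map_natCast, map_add, map_one, Nat.factorial_succ, Nat.cast_mul,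
    Nat.cast_succ, mul_inv, mul_inv_cancel_left₀ h0, mul_smul_comm, add_sub_add_right_eq_sub,
    Nat.cast_zero, sub_zero]
  rw [mul_comm]

theorem phiNeg_aeval_natCast {A : Type*} [CommRing A] [Algebra K A] (i m : ℕ) :
    Polynomial.aeval (m : A) (phiNeg K i) = (m.choose i : A) := by
  have h : (phiNeg K i).eval (m : K) = (m.choose i : K) := by
    rw [Nat.cast_choose_eq_descPochhammer_div, descPochhammer_eval_eq_prod_range, phiNeg]
    simp [Polynomial.eval_prod, div_eq_inv_mul]
  rw [← map_natCast (algebraMap K A) m, Polynomial.aeval_algebraMap_apply_eq_algebraMap_eval, h,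
    map_natCast]

theorem natCast_mul_phiNeg_aeval_add_one {A : Type*} [CommRing A] [IsDomain A] [Algebra K A]
    (i : ℕ) (z : A) :
    (i : A) * Polynomial.aeval (z + 1) (phiNeg K (i + 1)) =
      z * Polynomial.aeval z (phiNeg K i) - Polynomial.aeval z (phiNeg K (i + 1)) := by
  have : CharZero A := charZero_of_injective_algebraMap (FaithfulSMul.algebraMap_injective K A)
  have h0 : (i : A) + 1 ≠ 0 := by exact_mod_cast i.succ_ne_zero
  refine mul_left_cancel₀ h0 ?_
  linear_combination (i : A) * phiNeg_succ_aeval_add_one K i z + phiNeg_succ_aeval K i z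

/-- The variables `x_k` extended by `x_0 = -1`, so that `σ x_{k+1} = x_{k+1} + x_k` for all `k`. -/
def xvExt (n : ℕ) : ℕ → MvPolynomial (Fin n) K
  | 0 => -1
  | k + 1 => xv K n (k + 1)

theorem iterate_xvExt {n : ℕ} (f : MvPolynomial (Fin n) K →ₐ[K] MvPolynomial (Fin n) K)
    (hf : ∀ k < n, f (xvExt K n (k + 1)) = xvExt K n (k + 1) + xvExt K n k) (m k : ℕ)
    (hk : k ≤ n) :
    (f ^ m) (xvExt K n k) =
      ∑ j ∈ Finset.range (k + 1), (m.choose (k - j) : MvPolynomial (Fin n) K) * xvExt K n j := by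
  induction m generalizing k with
  | zero =>
    rw [Finset.sum_range_succ, Finset.sum_eq_zero]
    · simp
    · intro j hj
      rw [Nat.choose_eq_zero_of_lt (by simp at hj; omega)]
      simp
  | succ m ih =>
    rw [pow_succ, AlgHom.mul_apply]
    cases k with
    | zero => simp [xvExt]
    | succ k =>
      rw [hf k hk, map_add, ih _ hk, ih k (by omega), Finset.sum_range_succ,
        Finset.sum_range_succ _ (k + 1), add_right_comm, ← Finset.sum_add_distrib]
      congr 1
      · refine Finset.sum_congr rfl fun j hj => ?_
        rw [Nat.sub_add_comm (by simp at hj; omega), Nat.choose_succ_succ]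
        push_cast
        ring
      · simp

/-- The polynomial in `t` interpolating `m ↦ σ ^ m x_k`. -/
def xvFlow (n k : ℕ) : Polynomial (MvPolynomial (Fin n) K) :=
  ∑ j ∈ Finset.range (k + 1),
    Polynomial.mapAlg K _ (phiNeg K (k - j)) * Polynomial.C (xvExt K n j)

omit [CharZero K] in
theorem xvFlow_eval (n k : ℕ) (t : MvPolynomial (Fin n) K) :
    (xvFlow K n k).eval t =
      ∑ j ∈ Finset.range (k + 1), Polynomial.aeval t (phiNeg K (k - j)) * xvExt K n j := by
  simp only [xvFlow, Polynomial.eval_finsetSum, Polynomial.mapAlg_eq_map, Polynomial.eval_mul,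
    Polynomial.eval_map_algebraMap, Polynomial.eval_C]

theorem xvFlow_eval_xv_one (n i : ℕ) :
    (xvFlow K n (i + 1)).eval (xv K n 1) = if i = 0 then 0 else yv K n i := by
  rw [xvFlow_eval, Finset.sum_range_succ', Finset.sum_range_succ']
  split_ifs with hi
  · subst hi
    simp [phiNeg, xvExt]
  · rw [yv, natCast_mul_phiNeg_aeval_add_one, ← Finset.Ico_succ_right_eq_Icc,
      Finset.sum_Ico_eq_sum_range]
    have : ∀ j, i + 1 - (j + 1 + 1) = i - (1 + j) := by omega
    simp only [xvExt, this, add_comm 1, Nat.sub_zero, zero_add, Nat.add_sub_cancel,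
      Order.succ_eq_add_one]
    ring

theorem eq_C_of_eval_natCast {R : Type*} [CommRing R] [IsDomain R] [CharZero R]
    (p : Polynomial R) (w : R) (h : ∀ m : ℕ, p.eval (m : R) = w) : p = Polynomial.C w :=
  Polynomial.eq_of_infinite_eval_eq _ _ <|
    (Set.infinite_range_of_injective (Nat.cast_injective (R := R))).mono <| by
      rintro _ ⟨m, rfl⟩
      simp [h]

/-- Every `σ`-invariant polynomial `u(z_1,…,z_n)` satisfies `u(z_1,…,z_n) = u(0,y_2,…,y_n)`,
i.e. `u` is fixed by the endomorphism `z_1 ↦ 0`, `z_i ↦ y_i` (`2 ≤ i ≤ n`). -/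
theorem invariant_eq_sub_y {K : Type*} [Field K] [CharZero K] {n : ℕ} (hn : 2 ≤ n)
    (σ : MvPolynomial (Fin n) K ≃ₐ[K] MvPolynomial (Fin n) K)
    (hσ1 : σ (xv K n 1) = xv K n 1 - 1)
    (hσ : ∀ k, 2 ≤ k → k ≤ n → σ (xv K n k) = xv K n k + xv K n (k - 1)) :
    ∀ w : MvPolynomial (Fin n) K, σ w = w →
      MvPolynomial.aeval (fun i : Fin n => if (i : ℕ) = 0 then 0 else yv K n (i : ℕ)) w = w := by
  intro w hw
  have hext : ∀ k < n, (σ : MvPolynomial (Fin n) K →ₐ[K] MvPolynomial (Fin n) K)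
      (xvExt K n (k + 1)) = xvExt K n (k + 1) + xvExt K n k := by
    rintro (_ | k) hk
    · simpa [xvExt, sub_eq_add_neg] using hσ1
    · simpa [xvExt] using hσ (k + 2) (by omega) hk
  have hX : ∀ i : Fin n, xvExt K n ((i : ℕ) + 1) = MvPolynomial.X i := fun i => by
    simp [xvExt, xv]
  have hfix : ∀ m : ℕ, ((σ : MvPolynomial (Fin n) K →ₐ[K] MvPolynomial (Fin n) K) ^ m) w = w := by
    intro m
    induction m with
    | zero => simp
    | succ m ih => rw [pow_succ, AlgHom.mul_apply, AlgEquiv.coe_toAlgHom, hw, ih]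
  have heval : ∀ t : MvPolynomial (Fin n) K,
      (MvPolynomial.aeval (fun i : Fin n => xvFlow K n ((i : ℕ) + 1)) w).eval t =
        MvPolynomial.aeval (fun i : Fin n => (xvFlow K n ((i : ℕ) + 1)).eval t) w := by
    intro t
    have := MvPolynomial.comp_aeval_apply (fun i : Fin n => xvFlow K n ((i : ℕ) + 1))
      ((Polynomial.aeval (R := MvPolynomial (Fin n) K) t).restrictScalars K) w
    simpa [Polynomial.coe_aeval_eq_eval] using this
  have hflow := eq_C_of_eval_natCast
    (MvPolynomial.aeval (fun i : Fin n => xvFlow K n ((i : ℕ) + 1)) w) w fun m => by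
      rw [heval]
      conv_rhs => rw [← hfix m]
      rw [MvPolynomial.aeval_unique
        ((σ : MvPolynomial (Fin n) K →ₐ[K] MvPolynomial (Fin n) K) ^ m)]
      congr 2
      funext i
      rw [Function.comp_apply, ← hX, iterate_xvExt K _ hext m _ i.isLt, xvFlow_eval]
      simp only [phiNeg_aeval_natCast]
  simp only [← xvFlow_eval_xv_one]
  rw [← heval, hflow, Polynomial.eval_C]
end
end

section
/- Let τ be the K-algebra automorphism of K[x_1, x_2, x_3] with τ(x_1) = x_1, τ(x_2) = x_2 + x_1, τ(x_3) = x_3 + x_2, and set p_1 = x_2² − x_1x_2 − 2x_1x_3. Then the fixed algebra K[x_1, x_2, x_3]^τ equals the K-subalgebra generated by x_1 and p_1, and x_1, p_1 are algebraically independent over K; that is, K[x_1, x_2, x_3]^τ = K[x_1, p_1] is a polynomial ring in two variables. -/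
noncomputable section

open MvPolynomial

section FixedAlgebra

variable {K : Type*} [Field K]

/-- Clearing denominators in `f(a, 0, -t / (2a))`. -/
lemma exists_eval_eq_pow_mul_eval_neg_div (f : MvPolynomial (Fin 3) K) :
    ∃ (N : ℕ) (h : MvPolynomial (Fin 2) K), ∀ a t : K, a ≠ 0 →
      eval ![a, t] h = a ^ N * eval ![a, 0, -t / (2 * a)] f := by
  induction f using MvPolynomial.induction_on with
  | C c => exact ⟨0, C c, fun a t _ => by simp⟩
  | add f g hf hg =>
    obtain ⟨N, h, hN⟩ := hf
    obtain ⟨M, k, hM⟩ := hg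
    refine ⟨N + M, X 0 ^ M * h + X 0 ^ N * k, fun a t ha => ?_⟩
    simp only [map_add, map_mul, map_pow, eval_X, hN a t ha, hM a t ha, Matrix.cons_val_zero]
    ring
  | mul_X f i hf =>
    obtain ⟨N, h, hN⟩ := hf
    fin_cases i
    · refine ⟨N, h * X 0, fun a t ha => ?_⟩
      simp [hN a t ha, mul_assoc]
    · exact ⟨N, 0, fun a t _ => by simp⟩
    · refine ⟨N + 1, h * (C (-2⁻¹) * X 1), fun a t ha => ?_⟩
      simp [hN a t ha]
      field_simp
      ring

/-- A polynomial in two variables is a multiple of the first one plus a polynomial in the second. -/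
lemma exists_eq_X_zero_mul_add_aeval_X_one (h : MvPolynomial (Fin 2) K) :
    ∃ (k : MvPolynomial (Fin 2) K) (q : Polynomial K),
      h = X 0 * k + Polynomial.aeval (X 1) q := by
  induction h using MvPolynomial.induction_on with
  | C c => exact ⟨0, Polynomial.C c, by simp [algebraMap_eq]⟩
  | add f g hf hg =>
    obtain ⟨k, q, rfl⟩ := hf
    obtain ⟨l, r, rfl⟩ := hg
    exact ⟨k + l, q + r, by rw [map_add]; ring⟩
  | mul_X f i hf =>
    obtain ⟨k, q, rfl⟩ := hf
    fin_cases i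
    · exact ⟨X 0 * k + Polynomial.aeval (X 1) q, 0, by simp [mul_comm]⟩
    · exact ⟨k * X 1, q * Polynomial.X, by simp; ring⟩

lemma eval_aeval_X_zero_invariant (h : MvPolynomial (Fin 2) K) (v : Fin 3 → K) :
    eval v (aeval ![(X 0 : MvPolynomial (Fin 3) K), X 1 ^ 2 - X 0 * X 1 - 2 * X 0 * X 2] h) =
      eval ![v 0, v 1 ^ 2 - v 0 * v 1 - 2 * v 0 * v 2] h := by
  induction h using MvPolynomial.induction_on with
  | C c => simp [algebraMap_eq]
  | add f g hf hg => rw [map_add, map_add, hf, hg, map_add]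
  | mul_X f i hf =>
    rw [map_mul, map_mul, hf, map_mul, aeval_X, eval_X]
    fin_cases i <;> simp

variable [CharZero K]

/-- Invariance under `τ` extends from its iterates to the whole one-parameter group. -/
lemma eval_one_parameter_of_invariant (f : MvPolynomial (Fin 3) K)
    (hf : ∀ a b c : K, eval ![a, b + a, c + b] f = eval ![a, b, c] f) (a b c t : K) :
    eval ![a, b + t * a, c + t * b + t * (t - 1) / 2 * a] f = eval ![a, b, c] f := by
  have hnat : ∀ n : ℕ,
      eval ![a, b + n * a, c + n * b + n * (n - 1) / 2 * a] f = eval ![a, b, c] f := by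
    intro n
    induction n with
    | zero => simp
    | succ n ih =>
      refine Eq.trans ?_ ((hf _ _ _).trans ih)
      congr 4
      · push_cast
        ring
      · congr 1
        push_cast
        ring
  let q : Polynomial K := aeval ![Polynomial.C a, Polynomial.C b + Polynomial.X * Polynomial.C a,
    Polynomial.C c + Polynomial.X * Polynomial.C b +
      Polynomial.X * (Polynomial.X - 1) * Polynomial.C (2⁻¹ * a)] f
  have hq : ∀ s : K, q.eval s = eval ![a, b + s * a, c + s * b + s * (s - 1) / 2 * a] f := by
    intro s
    change Polynomial.eval s (aeval _ f) = _
    rw [← Polynomial.coe_aeval_eq_eval, ← AlgHom.coe_toRingHom, ← coe_aeval_eq_eval]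
    change ((Polynomial.aeval s).comp (aeval _)) f = aeval _ f
    congr 1
    ext i
    fin_cases i <;> simp <;> ring
  have hconst : q = Polynomial.C (eval ![a, b, c] f) := by
    refine Polynomial.eq_of_infinite_eval_eq _ _
      ((Set.infinite_range_of_injective (Nat.cast_injective (R := K))).mono ?_)
    rintro _ ⟨n, rfl⟩
    simp only [Set.mem_ofPred_eq, Polynomial.eval_C, hq, hnat]
  rw [← hq, hconst, Polynomial.eval_C]

lemma eq_of_eval_eq_of_ne_zero {n : ℕ} {f g : MvPolynomial (Fin (n + 1)) K}
    (h : ∀ v : Fin (n + 1) → K, v 0 ≠ 0 → eval v f = eval v g) : f = g := by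
  refine mul_left_cancel₀ (X_ne_zero (0 : Fin (n + 1))) (MvPolynomial.funext fun v => ?_)
  by_cases hv : v 0 = 0
  · simp [hv]
  · simp [h v hv]

lemma mem_range_aeval_of_X_zero_mul_mem {f : MvPolynomial (Fin 3) K}
    (hf : X 0 * f ∈ (aeval (R := K)
      ![(X 0 : MvPolynomial (Fin 3) K), X 1 ^ 2 - X 0 * X 1 - 2 * X 0 * X 2]).range) :
    f ∈ (aeval (R := K)
      ![(X 0 : MvPolynomial (Fin 3) K), X 1 ^ 2 - X 0 * X 1 - 2 * X 0 * X 2]).range := by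
  obtain ⟨h, hh⟩ := hf
  obtain ⟨k, q, rfl⟩ := exists_eq_X_zero_mul_add_aeval_X_one h
  have hq : Polynomial.expand K 2 q = 0 := by
    refine Polynomial.funext fun b => ?_
    have := congrArg (eval ![0, b, 0]) hh
    rw [AlgHom.toRingHom_eq_coe, AlgHom.coe_toRingHom, eval_aeval_X_zero_invariant] at this
    simp only [← coe_aeval_eq_eval, RingHom.coe_coe, map_add, map_mul, aeval_X,
      ← Polynomial.aeval_algHom_apply] at this
    simpa [Polynomial.expand_eval, Polynomial.coe_aeval_eq_eval] using this
  rw [Polynomial.expand_eq_zero two_pos] at hq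
  subst hq
  refine ⟨k, mul_left_cancel₀ (X_ne_zero (0 : Fin 3)) ?_⟩
  simpa using hh

lemma mem_range_aeval_of_invariant (f : MvPolynomial (Fin 3) K)
    (hf : ∀ a b c : K, eval ![a, b + a, c + b] f = eval ![a, b, c] f) :
    f ∈ (aeval (R := K)
      ![(X 0 : MvPolynomial (Fin 3) K), X 1 ^ 2 - X 0 * X 1 - 2 * X 0 * X 2]).range := by
  obtain ⟨N, h, hN⟩ := exists_eval_eq_pow_mul_eval_neg_div f
  have hmem : X 0 ^ N * f ∈ (aeval (R := K)
      ![(X 0 : MvPolynomial (Fin 3) K), X 1 ^ 2 - X 0 * X 1 - 2 * X 0 * X 2]).range := by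
    refine ⟨h, eq_of_eval_eq_of_ne_zero fun v hv => ?_⟩
    rw [AlgHom.toRingHom_eq_coe, AlgHom.coe_toRingHom, eval_aeval_X_zero_invariant, hN _ _ hv,
      map_mul, map_pow, eval_X]
    have hv3 : v = ![v 0, v 1, v 2] := by
      ext i
      fin_cases i <;> rfl
    conv_rhs => rw [hv3, ← eval_one_parameter_of_invariant f hf _ _ _ (-(v 1 / v 0))]
    congr 4
    simp only [Matrix.vecCons_inj, and_true]
    constructor <;>
    · field_simp
      ring
  clear hN
  induction N with
  | zero => simpa using hmem
  | succ N ih =>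
    rw [pow_succ' (X 0), mul_assoc (X 0)] at hmem
    exact ih (mem_range_aeval_of_X_zero_mul_mem hmem)

end FixedAlgebra

/-- For `τ : x_1 ↦ x_1, x_2 ↦ x_2 + x_1, x_3 ↦ x_3 + x_2` on `K[x_1,x_2,x_3]`, the fixed
algebra is the polynomial ring `K[x_1, p_1]` with `p_1 = x_2² − x_1x_2 − 2x_1x_3`. -/
theorem fixed_algebra_three_vars {K : Type*} [Field K] [CharZero K]
    (τ : MvPolynomial (Fin 3) K ≃ₐ[K] MvPolynomial (Fin 3) K)
    (h1 : τ (X 0) = X 0) (h2 : τ (X 1) = X 1 + X 0) (h3 : τ (X 2) = X 2 + X 1) :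
    (∀ pp : MvPolynomial (Fin 3) K,
        τ pp = pp ↔
          pp ∈ Algebra.adjoin K
            ({X 0, X 1 ^ 2 - X 0 * X 1 - 2 * X 0 * X 2} : Set (MvPolynomial (Fin 3) K)))
    ∧ AlgebraicIndependent K
        ![(X 0 : MvPolynomial (Fin 3) K), X 1 ^ 2 - X 0 * X 1 - 2 * X 0 * X 2] := by
  refine ⟨fun f => ⟨fun hf => ?_, fun hf => ?_⟩, ?_⟩
  · have heval : ∀ (a b c : K) (g : MvPolynomial (Fin 3) K),
        eval ![a, b + a, c + b] g = eval ![a, b, c] (τ g) := by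
      intro a b c g
      induction g using MvPolynomial.induction_on with
      | C r => rw [← algebraMap_eq, τ.commutes, algebraMap_eq, eval_C, eval_C]
      | add g k hg hk => simp [hg, hk]
      | mul_X g i hg =>
        rw [map_mul, map_mul, map_mul, hg]
        fin_cases i <;> simp [h1, h2, h3]
    have := mem_range_aeval_of_invariant f fun a b c => by rw [heval, hf]
    rwa [← Algebra.adjoin_range_eq_range_aeval, Matrix.range_cons, Matrix.range_cons,
      Matrix.range_empty, Set.union_empty, Set.singleton_union] at this
  · induction hf using Algebra.adjoin_induction with
    | mem x hx =>
      rcases hx with rfl | rfl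
      · exact h1
      · simp only [map_sub, map_mul, map_pow, h1, h2, h3, map_ofNat]
        ring
    | algebraMap r => exact τ.commutes r
    | add x y _ _ hx hy => rw [map_add, hx, hy]
    | mul x y _ _ hx hy => rw [map_mul, hx, hy]
  · rw [algebraicIndependent_iff]
    intro h hh
    refine eq_of_eval_eq_of_ne_zero fun v hv => ?_
    have := eval_aeval_X_zero_invariant h ![v 0, 0, -v 1 / (2 * v 0)]
    rw [hh, map_zero] at this
    rw [map_zero, this]
    congr 2
    ext i
    fin_cases i
    · simp
    · simp
      field_simp
end
end

section
/- Let τ be the K-algebra automorphism of P = K[x_1, x_2, x_3, x_4] with τ(x_1) = x_1 and τ(x_i) = x_i + x_{i−1} for i = 2, 3, 4, and let F = P^τ be the fixed algebra. With p_1 = x_2² − x_1(x_2 + 2x_3), q_1 = −x_2³ + 3x_1x_2x_3 + x_1²x_2 − 3x_1²x_4, and s = −3x_2²(x_3² − x_2(x_3 + 2x_4)) − 9x_1x_2(x_2 + 2x_3)x_4 + 8x_1x_3³ − x_1x_2x_3(5x_2 + 6x_3) + 9x_1²x_4² + 3x_1²(x_2 + 6x_3)x_4 + 8x_1²x_3²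 + 2x_1²x_2x_3, the following hold: (i) x_1, p_1, q_1, s are τ-invariant and generate F as a K-algebra; (ii) the relation x_1²s = q_1² + 3x_1p_1q_1 − p_1³ + 2x_1²p_1² holds in P; (iii) the monomials x_1^{i_1} p_1^{i_2} q_1^{i_3} s^{i_4} with i_1, i_2, i_4 ≥ 0 and i_3 ∈ {0, 1} form a K-vector-space basis of F (so the relation in (ii) is a defining relation for F). -/
noncomputable section

open MvPolynomial

variable (K : Type*) [Field K] [CharZero K]

/-- `p_1 = x_2² − x_1(x_2 + 2x_3)` (variables `x_1,x_2,x_3,x_4` are `X 0, X 1, X 2, X 3`). -/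
def p1 : MvPolynomial (Fin 4) K := X 1 ^ 2 - X 0 * (X 1 + 2 * X 2)

/-- `q_1 = −x_2³ + 3x_1x_2x_3 + x_1²x_2 − 3x_1²x_4`. -/
def q1 : MvPolynomial (Fin 4) K :=
  -(X 1 ^ 3) + 3 * X 0 * X 1 * X 2 + X 0 ^ 2 * X 1 - 3 * X 0 ^ 2 * X 3

/-- `s = −3x_2²(x_3² − x_2(x_3 + 2x_4)) − 9x_1x_2(x_2 + 2x_3)x_4 + 8x_1x_3³
  − x_1x_2x_3(5x_2 + 6x_3) + 9x_1²x_4² + 3x_1²(x_2 + 6x_3)x_4 + 8x_1²x_3² + 2x_1²x_2x_3`. -/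
def sInv : MvPolynomial (Fin 4) K :=
  -3 * X 1 ^ 2 * (X 2 ^ 2 - X 1 * (X 2 + 2 * X 3)) - 9 * X 0 * X 1 * (X 1 + 2 * X 2) * X 3
    + 8 * X 0 * X 2 ^ 3 - X 0 * X 1 * X 2 * (5 * X 1 + 6 * X 2) + 9 * X 0 ^ 2 * X 3 ^ 2
    + 3 * X 0 ^ 2 * (X 1 + 6 * X 2) * X 3 + 8 * X 0 ^ 2 * X 2 ^ 2 + 2 * X 0 ^ 2 * X 1 * X 2

set_option linter.unusedSectionVars false

/-- The monomial `x_1^{i_1} p_1^{i_2} q_1^{i_3} s^{i_4}`. -/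
def invMonomial (t : ℕ × ℕ × Fin 2 × ℕ) : MvPolynomial (Fin 4) K :=
  X 0 ^ t.1 * p1 K ^ t.2.1 * q1 K ^ (t.2.2.1 : ℕ) * sInv K ^ t.2.2.2

/-- The algebra generated by `x_1, p_1, q_1, s`. -/
def invAlgebra : Subalgebra K (MvPolynomial (Fin 4) K) :=
  Algebra.adjoin K {X 0, p1 K, q1 K, sInv K}

/-- The specialization `x_1 = x_3 = 0`, `x_2 = -y`, `x_4 = -w / 6`, sending `p_1, q_1, s` to the
monomials `y², y³, y³w`. -/
def specialization : MvPolynomial (Fin 4) K →ₐ[K] MvPolynomial (Fin 2) K :=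
  aeval ![0, -X 0, 0, -(C (6 : K)⁻¹ * X 1)]

lemma sq_mul_sInv : X 0 ^ 2 * sInv K
    = q1 K ^ 2 + 3 * X 0 * p1 K * q1 K - p1 K ^ 3 + 2 * X 0 ^ 2 * p1 K ^ 2 := by
  simp only [p1, q1, sInv]
  ring

lemma specialization_X_zero : specialization K (X 0) = 0 := by
  simp [specialization]

lemma specialization_p1 : specialization K (p1 K) = X 0 ^ 2 := by
  simp [specialization, p1]

lemma specialization_q1 : specialization K (q1 K) = X 0 ^ 3 := by
  simp only [specialization, q1, map_add, map_sub, map_mul, map_neg, map_pow, aeval_X, map_ofNat]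
  simp
  ring

lemma specialization_sInv : specialization K (sInv K) = X 0 ^ 3 * X 1 := by
  have h : (C (6 : K)⁻¹ : MvPolynomial (Fin 2) K) * 6 = 1 := by
    rw [← map_ofNat C 6, ← C_mul, inv_mul_cancel₀ (by norm_num), C_1]
  simp only [specialization, sInv, map_add, map_sub, map_mul, map_neg, map_pow, aeval_X, map_ofNat]
  simp
  linear_combination X 0 ^ 3 * X 1 * h

lemma linearIndependent_specialization_invMonomial :
    LinearIndependent K fun u : ℕ × Fin 2 × ℕ => specialization K (invMonomial K (0, u)) := by
  let e : ℕ × Fin 2 × ℕ → (Fin 2 →₀ ℕ) := fun u =>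
    Finsupp.single 0 (2 * u.1 + 3 * u.2.1 + 3 * u.2.2) + Finsupp.single 1 u.2.2
  have he : Function.Injective e := by
    rintro ⟨i, j, k⟩ ⟨i', j', k'⟩ h
    have h0 := DFunLike.congr_fun h 0
    have h1 := DFunLike.congr_fun h 1
    simp [e] at h0 h1
    have : (j : ℕ) = j' := by omega
    simp only [Prod.mk.injEq, Fin.ext_iff]
    omega
  have hmon : (fun u => specialization K (invMonomial K (0, u))) =
      basisMonomials (Fin 2) K ∘ e := by
    funext u
    simp only [invMonomial, map_mul, map_pow, specialization_p1, specialization_q1,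
      specialization_sInv, Function.comp, coe_basisMonomials, e, pow_zero, one_mul]
    rw [← mul_one (1 : K), ← monomial_mul, ← X_pow_eq_monomial, ← X_pow_eq_monomial]
    ring
  rw [hmon]
  exact (basisMonomials (Fin 2) K).linearIndependent.comp e he

lemma invMonomial_succ (a : ℕ) (u : ℕ × Fin 2 × ℕ) :
    invMonomial K (a + 1, u) = X 0 * invMonomial K (a, u) := by
  simp only [invMonomial]
  ring

lemma specialization_linearCombination_eq_zero {f : ℕ × Fin 2 × ℕ →₀ K}
    (h : specialization K (Finsupp.linearCombination K (fun u => invMonomial K (0, u)) f) = 0) :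
    f = 0 := by
  refine linearIndependent_iff.1 (linearIndependent_specialization_invMonomial K) f ?_
  rw [← h, ← AlgHom.toLinearMap_apply, Finsupp.apply_linearCombination]
  rfl

lemma eq_zero_of_sum_X_zero_pow_mul_eq_zero (n : ℕ) (f : ℕ → ℕ × Fin 2 × ℕ →₀ K)
    (h : ∑ a ∈ Finset.range n,
      X 0 ^ a * Finsupp.linearCombination K (fun u => invMonomial K (0, u)) (f a) = 0) :
    ∀ a < n, f a = 0 := by
  induction n generalizing f with
  | zero => simp
  | succ n ih =>
    simp only [Finset.sum_range_succ', pow_succ', mul_assoc, ← Finset.mul_sum, pow_zero,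
      one_mul] at h
    have h0 : f 0 = 0 := by
      apply specialization_linearCombination_eq_zero
      simpa [specialization_X_zero] using congrArg (specialization K) h
    rw [h0, map_zero, add_zero, mul_eq_zero, or_iff_right (X_ne_zero 0)] at h
    rintro (_ | a) ha
    · exact h0
    · exact ih (fun a => f (a + 1)) h a (by omega)

lemma linearIndependent_invMonomial : LinearIndependent K (invMonomial K) := by
  rw [linearIndependent_iff]
  intro c hc
  obtain ⟨n, hn⟩ := c.curry.support.bddAbove
  have hsupp : c.curry.support ⊆ Finset.range (n + 1) := fun a ha =>
    Finset.mem_range_succ_iff.2 (hn ha)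
  have key := eq_zero_of_sum_X_zero_pow_mul_eq_zero K (n + 1) c.curry ?_
  · ext ⟨a, u⟩
    rw [← Finsupp.curry_apply]
    by_cases ha : a < n + 1
    · rw [key a ha]; rfl
    · rw [Finsupp.notMem_support_iff.1 fun h => ha (Finset.mem_range.1 (hsupp h))]; rfl
  · rw [← hc, Finsupp.linearCombination_apply, ← Finsupp.sum_curry_index c
      (fun a u r => r • invMonomial K (a, u)),
      Finsupp.sum_of_support_subset _ hsupp _ (by simp)]
    refine Finset.sum_congr rfl fun a _ => ?_
    rw [Finsupp.linearCombination_apply, Finsupp.mul_sum]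
    refine Finsupp.sum_congr fun u _ => ?_
    simp only [invMonomial, mul_smul_comm, pow_zero, one_mul, mul_assoc]

lemma invMonomial_mem_span (t : ℕ × ℕ × Fin 2 × ℕ) :
    invMonomial K t ∈ Submodule.span K (Set.range (invMonomial K)) :=
  Submodule.subset_span ⟨t, rfl⟩

lemma mul_mem_span_invMonomial {g v : MvPolynomial (Fin 4) K}
    (hg : ∀ t, g * invMonomial K t ∈ Submodule.span K (Set.range (invMonomial K)))
    (hv : v ∈ Submodule.span K (Set.range (invMonomial K))) :
    g * v ∈ Submodule.span K (Set.range (invMonomial K)) := by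
  induction hv using Submodule.span_induction with
  | mem x hx => obtain ⟨t, rfl⟩ := hx; exact hg t
  | zero => simp
  | add x y _ _ hx hy => rw [mul_add]; exact add_mem hx hy
  | smul r x _ hx => rw [mul_smul_comm]; exact Submodule.smul_mem _ r hx

lemma X_zero_mul_mem_span {v : MvPolynomial (Fin 4) K}
    (hv : v ∈ Submodule.span K (Set.range (invMonomial K))) :
    X 0 * v ∈ Submodule.span K (Set.range (invMonomial K)) :=
  mul_mem_span_invMonomial K
    (fun ⟨a, u⟩ => invMonomial_succ K a u ▸ invMonomial_mem_span K (a + 1, u)) hv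

lemma q1_mul_invMonomial_mem_span (t : ℕ × ℕ × Fin 2 × ℕ) :
    q1 K * invMonomial K t ∈ Submodule.span K (Set.range (invMonomial K)) := by
  obtain ⟨a, i, j, k⟩ := t
  fin_cases j
  · convert invMonomial_mem_span K (a, i, 1, k) using 1
    change q1 K * invMonomial K (a, i, 0, k) = _
    simp only [invMonomial, Fin.val_zero, Fin.val_one]
    ring
  · have h : q1 K * invMonomial K (a, i, 1, k) = invMonomial K (a + 2, i, 0, k + 1)
        - (3 : K) • invMonomial K (a + 1, i + 1, 1, k) + invMonomial K (a, i + 3, 0, k)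
        - (2 : K) • invMonomial K (a + 2, i + 2, 0, k) := by
      simp only [invMonomial, smul_eq_C_mul, map_ofNat, Fin.val_zero, Fin.val_one]
      linear_combination -X 0 ^ a * p1 K ^ i * sInv K ^ k * sq_mul_sInv K
    change q1 K * invMonomial K (a, i, 1, k) ∈ _
    rw [h]
    exact sub_mem (add_mem (sub_mem (invMonomial_mem_span K _)
      (Submodule.smul_mem _ _ (invMonomial_mem_span K _))) (invMonomial_mem_span K _))
      (Submodule.smul_mem _ _ (invMonomial_mem_span K _))

lemma span_invMonomial :
    Submodule.span K (Set.range (invMonomial K)) = Subalgebra.toSubmodule (invAlgebra K) := by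
  apply le_antisymm
  · rw [Submodule.span_le]
    rintro _ ⟨t, rfl⟩
    have hmem : ∀ g ∈ ({X 0, p1 K, q1 K, sInv K} : Set (MvPolynomial (Fin 4) K)),
        g ∈ invAlgebra K := fun g hg => Algebra.subset_adjoin hg
    change invMonomial K t ∈ invAlgebra K
    exact mul_mem (mul_mem (mul_mem (pow_mem (hmem _ (by simp)) _) (pow_mem (hmem _ (by simp)) _))
      (pow_mem (hmem _ (by simp)) _)) (pow_mem (hmem _ (by simp)) _)
  · intro g hg
    suffices h : ∀ v ∈ Submodule.span K (Set.range (invMonomial K)),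
        g * v ∈ Submodule.span K (Set.range (invMonomial K)) by
      simpa [invMonomial] using h _ (invMonomial_mem_span K (0, 0, 0, 0))
    rw [Subalgebra.mem_toSubmodule] at hg
    induction hg using Algebra.adjoin_induction with
    | mem g hg =>
      intro v hv
      rcases hg with rfl | rfl | rfl | rfl
      · exact X_zero_mul_mem_span K hv
      · refine mul_mem_span_invMonomial K (fun ⟨a, i, j, k⟩ => ?_) hv
        convert invMonomial_mem_span K (a, i + 1, j, k) using 1
        simp only [invMonomial]
        ring
      · exact mul_mem_span_invMonomial K (q1_mul_invMonomial_mem_span K) hv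
      · refine mul_mem_span_invMonomial K (fun ⟨a, i, j, k⟩ => ?_) hv
        convert invMonomial_mem_span K (a, i, j, k + 1) using 1
        simp only [invMonomial]
        ring
    | algebraMap r =>
      intro v hv
      rw [← Algebra.smul_def]
      exact Submodule.smul_mem _ r hv
    | add x y _ _ hx hy =>
      intro v hv
      rw [add_mul]
      exact add_mem (hx v hv) (hy v hv)
    | mul x y _ _ hx hy =>
      intro v hv
      rw [mul_assoc]
      exact hx _ (hy v hv)

lemma exists_eq_linearCombination_add_X_zero_mul {v : MvPolynomial (Fin 4) K}
    (hv : v ∈ Submodule.span K (Set.range (invMonomial K))) :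
    ∃ f : ℕ × Fin 2 × ℕ →₀ K, ∃ w ∈ Submodule.span K (Set.range (invMonomial K)),
      v = Finsupp.linearCombination K (fun u => invMonomial K (0, u)) f + X 0 * w := by
  induction hv using Submodule.span_induction with
  | mem x hx =>
    obtain ⟨⟨_ | a, u⟩, rfl⟩ := hx
    · exact ⟨Finsupp.single u 1, 0, zero_mem _, by simp⟩
    · exact ⟨0, invMonomial K (a, u), invMonomial_mem_span K _, by simp [invMonomial_succ]⟩
  | zero => exact ⟨0, 0, zero_mem _, by simp⟩
  | add x y _ _ hx hy =>
    obtain ⟨f, w, hw, rfl⟩ := hx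
    obtain ⟨f', w', hw', rfl⟩ := hy
    exact ⟨f + f', w + w', add_mem hw hw', by rw [map_add]; ring⟩
  | smul r x _ hx =>
    obtain ⟨f, w, hw, rfl⟩ := hx
    exact ⟨r • f, r • w, Submodule.smul_mem _ r hw, by
      rw [map_smul, smul_add, mul_smul_comm]⟩

lemma mem_span_of_X_zero_mul_mem {f : MvPolynomial (Fin 4) K}
    (hf : X 0 * f ∈ Submodule.span K (Set.range (invMonomial K))) :
    f ∈ Submodule.span K (Set.range (invMonomial K)) := by
  obtain ⟨c, w, hw, h⟩ := exists_eq_linearCombination_add_X_zero_mul K hf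
  have hc : c = 0 := by
    apply specialization_linearCombination_eq_zero
    simpa [specialization_X_zero] using (congrArg (specialization K) h).symm
  rw [hc, map_zero, zero_add] at h
  rwa [mul_left_cancel₀ (X_ne_zero 0) h]

lemma mem_invAlgebra_of_X_zero_pow_mul_mem {f : MvPolynomial (Fin 4) K} {n : ℕ}
    (hf : X 0 ^ n * f ∈ invAlgebra K) : f ∈ invAlgebra K := by
  simp only [← Subalgebra.mem_toSubmodule, ← span_invMonomial] at hf ⊢
  induction n with
  | zero => simpa using hf
  | succ n ih => exact ih (mem_span_of_X_zero_mul_mem K (by rwa [← mul_assoc, ← pow_succ']))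

lemma exists_aeval_eq_X_zero_sq_mul_X (i : Fin 4) : ∃ G : Polynomial (invAlgebra K),
    Polynomial.aeval (X 1 : MvPolynomial (Fin 4) K) G = X 0 ^ 2 * X i := by
  let x : invAlgebra K := ⟨X 0, Algebra.subset_adjoin (by simp)⟩
  let p : invAlgebra K := ⟨p1 K, Algebra.subset_adjoin (by simp)⟩
  let q : invAlgebra K := ⟨q1 K, Algebra.subset_adjoin (by simp)⟩
  let Y : Polynomial (invAlgebra K) := Polynomial.X
  let c (r : K) : Polynomial (invAlgebra K) := Polynomial.C (algebraMap K _ r)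
  have hY : Polynomial.aeval (X 1 : MvPolynomial (Fin 4) K) Y = X 1 := Polynomial.aeval_X _
  have hC (a : invAlgebra K) :
      Polynomial.aeval (X 1 : MvPolynomial (Fin 4) K) (Polynomial.C a) = a :=
    Polynomial.aeval_C _ _
  have hc (r : K) : Polynomial.aeval (X 1 : MvPolynomial (Fin 4) K) (c r) = C r := hC _
  have h2 : (C (2 : K)⁻¹ : MvPolynomial (Fin 4) K) * 2 = 1 := by
    rw [← map_ofNat C 2, ← C_mul, inv_mul_cancel₀ (by norm_num), C_1]
  have h3 : (C (3 : K)⁻¹ : MvPolynomial (Fin 4) K) * 3 = 1 := by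
    rw [← map_ofNat C 3, ← C_mul, inv_mul_cancel₀ (by norm_num), C_1]
  clear_value Y c
  let Z := c 2⁻¹ * (Y ^ 2 + Polynomial.C (-x) * Y + Polynomial.C (-p))
  have hZ : Polynomial.aeval (X 1 : MvPolynomial (Fin 4) K) Z = X 0 * X 2 := by
    simp only [Z, map_mul, map_add, map_pow, hY, hC, hc]
    change C (2 : K)⁻¹ * (X 1 ^ 2 + -X 0 * X 1 + -p1 K) = X 0 * X 2
    simp only [p1]
    linear_combination X 0 * X 2 * h2
  clear_value Z
  fin_cases i
  · exact ⟨Polynomial.C (x ^ 2 * x), by rw [hC]; rfl⟩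
  · exact ⟨Polynomial.C (x ^ 2) * Y, by rw [map_mul, hC, hY]; rfl⟩
  · refine ⟨Polynomial.C x * Z, ?_⟩
    rw [map_mul, hC, hZ]
    change X 0 * (X 0 * X 2) = X 0 ^ 2 * X 2
    ring
  · refine ⟨c 3⁻¹ * (c 3 * Z * Y + c (-1) * Y ^ 3 + Polynomial.C (x ^ 2) * Y
      + Polynomial.C (-q)), ?_⟩
    simp only [map_mul, map_add, map_pow _ Y, hY, hC, hc, hZ]
    change C (3 : K)⁻¹ * (C 3 * (X 0 * X 2) * X 1 + C (-1) * X 1 ^ 3 + X 0 ^ 2 * X 1 + -q1 K)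
      = X 0 ^ 2 * X 3
    simp only [q1, map_ofNat, map_neg, map_one]
    linear_combination X 0 ^ 2 * X 3 * h3

lemma exists_aeval_eq_X_zero_pow_mul (f : MvPolynomial (Fin 4) K) :
    ∃ n : ℕ, ∃ G : Polynomial (invAlgebra K),
      Polynomial.aeval (X 1 : MvPolynomial (Fin 4) K) G = X 0 ^ n * f := by
  let x : invAlgebra K := ⟨X 0, Algebra.subset_adjoin (by simp)⟩
  have hx (n : ℕ) : Polynomial.aeval (X 1 : MvPolynomial (Fin 4) K) (Polynomial.C (x ^ n))
      = X 0 ^ n := Polynomial.aeval_C _ _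
  induction f using MvPolynomial.induction_on with
  | C a =>
    exact ⟨0, Polynomial.C (algebraMap K _ a), by
      rw [Polynomial.aeval_C, pow_zero, one_mul]; rfl⟩
  | add f g hf hg =>
    obtain ⟨n, G, hG⟩ := hf
    obtain ⟨m, H, hH⟩ := hg
    refine ⟨n + m, Polynomial.C (x ^ m) * G + Polynomial.C (x ^ n) * H, ?_⟩
    rw [map_add, map_mul, map_mul, hx, hx, hG, hH]
    ring
  | mul_X f i hf =>
    obtain ⟨n, G, hG⟩ := hf
    obtain ⟨H, hH⟩ := exists_aeval_eq_X_zero_sq_mul_X K i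
    refine ⟨n + 2, G * H, ?_⟩
    rw [map_mul, hG, hH]
    ring

section Fixed

variable {K}
variable {τ : MvPolynomial (Fin 4) K ≃ₐ[K] MvPolynomial (Fin 4) K}

lemma map_p1 (h1 : τ (X 0) = X 0) (h2 : τ (X 1) = X 1 + X 0) (h3 : τ (X 2) = X 2 + X 1) :
    τ (p1 K) = p1 K := by
  simp only [p1, map_sub, map_mul, map_add, map_pow, map_ofNat, h1, h2, h3]
  ring

lemma map_q1 (h1 : τ (X 0) = X 0) (h2 : τ (X 1) = X 1 + X 0) (h3 : τ (X 2) = X 2 + X 1)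
    (h4 : τ (X 3) = X 3 + X 2) : τ (q1 K) = q1 K := by
  simp only [q1, map_sub, map_mul, map_add, map_neg, map_pow, map_ofNat, h1, h2, h3, h4]
  ring

lemma map_sInv (h1 : τ (X 0) = X 0) (h2 : τ (X 1) = X 1 + X 0) (h3 : τ (X 2) = X 2 + X 1)
    (h4 : τ (X 3) = X 3 + X 2) : τ (sInv K) = sInv K := by
  simp only [sInv, map_sub, map_mul, map_add, map_neg, map_pow, map_ofNat, h1, h2, h3, h4]
  ring

lemma map_of_mem_invAlgebra (h1 : τ (X 0) = X 0) (h2 : τ (X 1) = X 1 + X 0)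
    (h3 : τ (X 2) = X 2 + X 1) (h4 : τ (X 3) = X 3 + X 2) {f : MvPolynomial (Fin 4) K}
    (hf : f ∈ invAlgebra K) : τ f = f := by
  have h : invAlgebra K ≤ AlgHom.equalizer (τ : _ →ₐ[K] _) (AlgHom.id K _) := by
    refine Algebra.adjoin_le ?_
    rintro g (rfl | rfl | rfl | rfl)
    exacts [h1, map_p1 h1 h2 h3, map_q1 h1 h2 h3 h4, map_sInv h1 h2 h3 h4]
  exact h hf

lemma mem_invAlgebra_of_map_eq (h1 : τ (X 0) = X 0) (h2 : τ (X 1) = X 1 + X 0)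
    (h3 : τ (X 2) = X 2 + X 1) (h4 : τ (X 3) = X 3 + X 2) {f : MvPolynomial (Fin 4) K}
    (hf : τ f = f) : f ∈ invAlgebra K := by
  obtain ⟨n, G, hG⟩ := exists_aeval_eq_X_zero_pow_mul K f
  have hτ (y : MvPolynomial (Fin 4) K) :
      Polynomial.aeval (τ y) G = τ (Polynomial.aeval y G) := by
    simp only [Polynomial.aeval_eq_sum_range, map_sum, Algebra.smul_def, map_mul, map_pow]
    refine Finset.sum_congr rfl fun i _ => ?_
    rw [show τ (algebraMap (invAlgebra K) _ (G.coeff i)) = algebraMap (invAlgebra K) _ (G.coeff i)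
      from map_of_mem_invAlgebra h1 h2 h3 h4 (G.coeff i).2]
  have hroot (m : ℕ) : Polynomial.aeval (X 1 + (m : MvPolynomial (Fin 4) K) * X 0) G
      = X 0 ^ n * f := by
    induction m with
    | zero => simpa using hG
    | succ m ih =>
      have h := hτ (X 1 + (m : MvPolynomial (Fin 4) K) * X 0)
      rw [ih, map_mul, map_pow, h1, hf, map_add, map_mul, map_natCast, h1, h2] at h
      rw [← h, Nat.cast_succ, add_mul, one_mul, add_right_comm, add_assoc (X 1)]
  have hconst : G.map (algebraMap (invAlgebra K) (MvPolynomial (Fin 4) K))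
      = Polynomial.C (X 0 ^ n * f) := by
    refine Polynomial.eq_of_infinite_eval_eq _ _ (Set.Infinite.mono ?_
      (Set.infinite_range_of_injective
      (f := fun m : ℕ => (X 1 + (m : MvPolynomial (Fin 4) K) * X 0)) fun a b hab => ?_))
    · rintro _ ⟨m, rfl⟩
      simpa [Polynomial.eval_map_algebraMap] using hroot m
    · exact_mod_cast mul_right_cancel₀ (X_ne_zero 0) (add_left_cancel hab)
  have hcoeff := congrArg (fun H => Polynomial.coeff H 0) hconst
  rw [Polynomial.coeff_map, Polynomial.coeff_C_zero] at hcoeff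
  exact mem_invAlgebra_of_X_zero_pow_mul_mem K (n := n) (hcoeff ▸ (G.coeff 0).2)

end Fixed

/-- The fixed algebra of `K[x_1,x_2,x_3,x_4]` under `τ : x_1 ↦ x_1, x_i ↦ x_i + x_{i−1}` is
generated by `x_1, p_1, q_1, s`, subject to the defining relation
`x_1²s = q_1² + 3x_1p_1q_1 − p_1³ + 2x_1²p_1²`; the monomials
`x_1^{i_1} p_1^{i_2} q_1^{i_3} s^{i_4}` with `i_3 ∈ {0,1}` form a `K`-basis. -/
theorem fixed_algebra_four_vars {K : Type*} [Field K] [CharZero K]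
    (τ : MvPolynomial (Fin 4) K ≃ₐ[K] MvPolynomial (Fin 4) K)
    (h1 : τ (X 0) = X 0) (h2 : τ (X 1) = X 1 + X 0) (h3 : τ (X 2) = X 2 + X 1)
    (h4 : τ (X 3) = X 3 + X 2) :
    (τ (p1 K) = p1 K ∧ τ (q1 K) = q1 K ∧ τ (sInv K) = sInv K
      ∧ ∀ pp : MvPolynomial (Fin 4) K,
          τ pp = pp ↔
            pp ∈ Algebra.adjoin K ({X 0, p1 K, q1 K, sInv K} : Set (MvPolynomial (Fin 4) K)))
    ∧ (X 0 ^ 2 * sInv K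
        = q1 K ^ 2 + 3 * X 0 * p1 K * q1 K - p1 K ^ 3 + 2 * X 0 ^ 2 * p1 K ^ 2)
    ∧ (LinearIndependent K
          (fun t : ℕ × ℕ × Fin 2 × ℕ =>
            X 0 ^ t.1 * p1 K ^ t.2.1 * q1 K ^ (t.2.2.1 : ℕ) * sInv K ^ t.2.2.2)
        ∧ (Submodule.span K
              (Set.range fun t : ℕ × ℕ × Fin 2 × ℕ =>
                X 0 ^ t.1 * p1 K ^ t.2.1 * q1 K ^ (t.2.2.1 : ℕ) * sInv K ^ t.2.2.2) :
              Set (MvPolynomial (Fin 4) K))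
            = {pp : MvPolynomial (Fin 4) K | τ pp = pp}) := by
  have hfix (f : MvPolynomial (Fin 4) K) : τ f = f ↔ f ∈ invAlgebra K :=
    ⟨mem_invAlgebra_of_map_eq h1 h2 h3 h4, map_of_mem_invAlgebra h1 h2 h3 h4⟩
  refine ⟨⟨map_p1 h1 h2 h3, map_q1 h1 h2 h3 h4, map_sInv h1 h2 h3 h4, hfix⟩, sq_mul_sInv K,
    linearIndependent_invMonomial K, ?_⟩
  ext f
  exact (SetLike.ext_iff.1 (span_invMonomial K) f).trans (hfix f).symm
end
end
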